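/- Let Ω ⊂ ℝ be an open bounded interval, let f satisfy hypothesis (F), let the data satisfy hypothesis (I), let T > 0, and let (u,Θ) be a weak solution of system (P) on Ω×(0,T) belonging to the regularity class (R_T). Then the energy identity ½∫_Ω u_t²(·,t) + ½∫_Ω u_x²(·,t) + ∫_Ω Θ(·,t) = ½∫_Ω u_{0t}² + ½∫_Ω u_{0x}² + ∫_Ω Θ₀ holds for all t ∈ (0,T). -/

import Mathlib

open MeasureTheory Filter Set Function

noncomputable section

/-- Integral over `Ω = (a,b)`. -/
def intOm (a b : ℝ) (g : ℝ → ℝ) : ℝ := ∫ x in Ioo a b, g x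

/-- Double integral over `Ω × (0,T)`. -/
def intOmT (a b T : ℝ) (F : ℝ → ℝ → ℝ) : ℝ :=
  ∫ p in (Ioo a b) ×ˢ (Ioo 0 T), F p.1 p.2

/-- Squared `L²(Ω)` integral of `g`. -/
def sqOm (a b : ℝ) (g : ℝ → ℝ) : ℝ := ∫ x in Ioo a b, (g x) ^ 2

/-- `L²(Ω)` norm. -/
def nrmL2 (a b : ℝ) (g : ℝ → ℝ) : ℝ := (∫ x in Ioo a b, (g x) ^ 2) ^ (1 / 2 : ℝ)

/-- `L¹(Ω)` norm. -/
def nrmL1 (a b : ℝ) (g : ℝ → ℝ) : ℝ := ∫ x in Ioo a b, |g x|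

/-- Membership in `L²(Ω)`. -/
def MemL2 (a b : ℝ) (g : ℝ → ℝ) : Prop :=
  AEStronglyMeasurable g (volume.restrict (Ioo a b)) ∧
    IntegrableOn (fun x => (g x) ^ 2) (Ioo a b)

/-- Zero-trace weak derivative on `(a,b)`: `g ∈ W₀^{1,1}(a,b)` with weak derivative `g'`
(integration by parts against all smooth test functions, with no boundary terms). -/
def WeakDerivZ (a b : ℝ) (g g' : ℝ → ℝ) : Prop :=
  ∀ ψ : ℝ → ℝ, ContDiff ℝ (⊤ : ℕ∞) ψ →
    ∫ x in Ioo a b, g x * deriv ψ x = - ∫ x in Ioo a b, g' x * ψ x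

/-- Interior weak derivative on `(a,b)`: `g ∈ W^{1,1}(a,b)` with weak derivative `g'`. -/
def WeakDerivI (a b : ℝ) (g g' : ℝ → ℝ) : Prop :=
  ∀ ψ : ℝ → ℝ, ContDiff ℝ (⊤ : ℕ∞) ψ → tsupport ψ ⊆ Ioo a b →
    ∫ x in Ioo a b, g x * deriv ψ x = - ∫ x in Ioo a b, g' x * ψ x

/-- Hypothesis (F) on the nonlinearity `f`, where `f'`, `f''` denote its first and second
derivatives on `[0,∞)`: `f ∈ C²([0,∞))`, `f(0)=0`, `f' > 0` on `[0,∞)`,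
and `f' ∈ W^{1,∞}((0,∞))` (i.e. `f'` and `f''` are bounded). -/
structure HypF (f f' f'' : ℝ → ℝ) : Prop where
  hasDeriv₁ : ∀ x ∈ Ici (0 : ℝ), HasDerivWithinAt f (f' x) (Ici 0) x
  hasDeriv₂ : ∀ x ∈ Ici (0 : ℝ), HasDerivWithinAt f' (f'' x) (Ici 0) x
  cont₂ : ContinuousOn f'' (Ici 0)
  zero : f 0 = 0
  pos : ∀ x ∈ Ici (0 : ℝ), 0 < f' x
  bdd : ∃ M : ℝ, ∀ x ∈ Ici (0 : ℝ), |f' x| ≤ M ∧ |f'' x| ≤ M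

/-- Partial derivative in the first (spatial) variable. -/
def pdx (w : ℝ → ℝ → ℝ) : ℝ → ℝ → ℝ := fun x t => deriv (fun y => w y t) x

/-- Partial derivative in the second (time) variable. -/
def pdt (w : ℝ → ℝ → ℝ) : ℝ → ℝ → ℝ := fun x t => deriv (fun s => w x s) t

/-- Test functions in `C₀^∞(Ω × [0,T))`. -/
structure TestU (a b T : ℝ) (φ : ℝ → ℝ → ℝ) : Prop where
  smooth : ContDiff ℝ (⊤ : ℕ∞) (uncurry φ)
  suppx : ∃ K : Set ℝ, IsCompact K ∧ K ⊆ Ioo a b ∧ ∀ x t, x ∉ K → φ x t = 0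
  suppt : ∃ T' : ℝ, T' < T ∧ ∀ x t, T' ≤ t → φ x t = 0

/-- Test functions in `C^∞(Ω̄ × [0,T))`, compactly supported in time. -/
structure TestT (T : ℝ) (φ : ℝ → ℝ → ℝ) : Prop where
  smooth : ContDiff ℝ (⊤ : ℕ∞) (uncurry φ)
  suppt : ∃ T' : ℝ, T' < T ∧ ∀ x t, T' ≤ t → φ x t = 0

/-- Test functions in `C₀^∞(Ω × (0,T))`. -/
structure TestInt (a b T : ℝ) (φ : ℝ → ℝ → ℝ) : Prop where
  smooth : ContDiff ℝ (⊤ : ℕ∞) (uncurry φ)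
  suppx : ∃ K : Set ℝ, IsCompact K ∧ K ⊆ Ioo a b ∧ ∀ x t, x ∉ K → φ x t = 0
  supptime : ∃ K : Set ℝ, IsCompact K ∧ K ⊆ Ioo 0 T ∧ ∀ x t, t ∉ K → φ x t = 0

/-- Definition (W): weak solution of (P) on `Ω × (0,T)`.  Here `ut`, `ux`, `Θx` denote
the weak derivatives of `u` (in time and space) and of `Θ` (in space). -/
structure IsWeakSol (a b T : ℝ) (f f' : ℝ → ℝ) (u0 u0t Θ0 : ℝ → ℝ)
    (u ut ux Θ Θx : ℝ → ℝ → ℝ) : Prop where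
  u_sliceL1 : ∀ t ∈ Icc 0 T, IntegrableOn (fun x => u x t) (Ioo a b)
  u_contL1 : ∀ t₀ ∈ Icc 0 T,
    Tendsto (fun t => ∫ x in Ioo a b, |u x t - u x t₀|) (nhdsWithin t₀ (Icc 0 T)) (nhds 0)
  u_int : IntegrableOn (fun p : ℝ × ℝ => u p.1 p.2) ((Ioo a b) ×ˢ (Ioo 0 T))
  ux_int : IntegrableOn (fun p : ℝ × ℝ => ux p.1 p.2) ((Ioo a b) ×ˢ (Ioo 0 T))
  u_W0 : ∀ᵐ t ∂volume.restrict (Ioo 0 T), WeakDerivZ a b (fun x => u x t) (fun x => ux x t)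
  Θ_int : IntegrableOn (fun p : ℝ × ℝ => Θ p.1 p.2) ((Ioo a b) ×ˢ (Ioo 0 T))
  Θx_int : IntegrableOn (fun p : ℝ × ℝ => Θx p.1 p.2) ((Ioo a b) ×ˢ (Ioo 0 T))
  Θ_W : ∀ᵐ t ∂volume.restrict (Ioo 0 T), WeakDerivI a b (fun x => Θ x t) (fun x => Θx x t)
  Θ_nonneg : ∀ᵐ p ∂volume.restrict ((Ioo a b) ×ˢ (Ioo 0 T)), 0 ≤ Θ p.1 p.2
  ut_weak : ∀ φ : ℝ → ℝ → ℝ, TestInt a b T φ →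
    intOmT a b T (fun x t => u x t * pdt φ x t) = - intOmT a b T (fun x t => ut x t * φ x t)
  ut_int : IntegrableOn (fun p : ℝ × ℝ => ut p.1 p.2) ((Ioo a b) ×ˢ (Ioo 0 T))
  g1_int : IntegrableOn (fun p : ℝ × ℝ => f' (Θ p.1 p.2) * Θx p.1 p.2)
    ((Ioo a b) ×ˢ (Ioo 0 T))
  g2_int : IntegrableOn (fun p : ℝ × ℝ => f' (Θ p.1 p.2) * Θx p.1 p.2 * ut p.1 p.2)
    ((Ioo a b) ×ˢ (Ioo 0 T))
  g3_int : IntegrableOn (fun p : ℝ × ℝ => f (Θ p.1 p.2) * ut p.1 p.2)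
    ((Ioo a b) ×ˢ (Ioo 0 T))
  weak_u : ∀ φ : ℝ → ℝ → ℝ, TestU a b T φ →
    intOmT a b T (fun x t => u x t * pdt (pdt φ) x t)
        - intOm a b (fun x => u0t x * φ x 0) + intOm a b (fun x => u0 x * pdt φ x 0)
      = - intOmT a b T (fun x t => ux x t * pdx φ x t)
        - intOmT a b T (fun x t => f' (Θ x t) * Θx x t * φ x t)
  weak_Θ : ∀ φ : ℝ → ℝ → ℝ, TestT T φ →
    - intOmT a b T (fun x t => Θ x t * pdt φ x t) - intOm a b (fun x => Θ0 x * φ x 0)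
      = - intOmT a b T (fun x t => Θx x t * pdx φ x t)
        + intOmT a b T (fun x t => f' (Θ x t) * Θx x t * ut x t * φ x t)
        + intOmT a b T (fun x t => f (Θ x t) * ut x t * pdx φ x t)

/-- Continuity of `t ↦ w(·,t)` as a map `J → L²(Ω)` (with slices in `L²(Ω)`). -/
def ContL2 (a b : ℝ) (J : Set ℝ) (w : ℝ → ℝ → ℝ) : Prop :=
  (∀ t ∈ J, MemL2 a b (fun x => w x t)) ∧
    ∀ t₀ ∈ J, Tendsto (fun t => ∫ x in Ioo a b, (w x t - w x t₀) ^ 2)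
      (nhdsWithin t₀ J) (nhds 0)

/-- The regularity class (R_T):  `u ∈ C⁰([0,T];W₀^{1,2})`, `u_t ∈ C⁰([0,T];L²)`,
`Θ ∈ C⁰([0,T];L²) ∩ L²((0,T);W^{1,2})`. -/
structure RegT (a b T : ℝ) (u ut ux Θ Θx : ℝ → ℝ → ℝ) : Prop where
  u_cont : ContL2 a b (Icc 0 T) u
  ux_cont : ContL2 a b (Icc 0 T) ux
  u_W0 : ∀ t ∈ Icc (0 : ℝ) T, WeakDerivZ a b (fun x => u x t) (fun x => ux x t)
  ut_cont : ContL2 a b (Icc 0 T) ut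
  Θ_cont : ContL2 a b (Icc 0 T) Θ
  Θ_sq_int : IntegrableOn (fun p : ℝ × ℝ => (Θ p.1 p.2) ^ 2) ((Ioo a b) ×ˢ (Ioo 0 T))
  Θx_sq_int : IntegrableOn (fun p : ℝ × ℝ => (Θx p.1 p.2) ^ 2) ((Ioo a b) ×ˢ (Ioo 0 T))

/-- Data hypothesis (I), with `u0x` the weak derivative of `u0 ∈ W₀^{1,2}(Ω)`. -/
structure DataI (a b : ℝ) (u0 u0x u0t Θ0 : ℝ → ℝ) : Prop where
  u0_L2 : MemL2 a b u0
  u0x_L2 : MemL2 a b u0x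
  u0_W0 : WeakDerivZ a b u0 u0x
  u0t_L2 : MemL2 a b u0t
  Θ0_L2 : MemL2 a b Θ0
  Θ0_nonneg : ∀ᵐ x ∂volume.restrict (Ioo a b), 0 ≤ Θ0 x

/-- Smooth-data hypothesis (I∞). -/
structure SmoothData (a b : ℝ) (v0 u0 Θ0 : ℝ → ℝ) : Prop where
  v0_smooth : ContDiff ℝ (⊤ : ℕ∞) v0
  v0_supp : ∃ K : Set ℝ, IsCompact K ∧ K ⊆ Ioo a b ∧ ∀ x, x ∉ K → v0 x = 0
  u0_smooth : ContDiff ℝ (⊤ : ℕ∞) u0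
  u0_supp : ∃ K : Set ℝ, IsCompact K ∧ K ⊆ Ioo a b ∧ ∀ x, x ∉ K → u0 x = 0
  Θ0_smooth : ContDiff ℝ (⊤ : ℕ∞) Θ0
  Θ0_pos : ∀ x ∈ Icc a b, 0 < Θ0 x
  Θ0x_supp : ∃ K : Set ℝ, IsCompact K ∧ K ⊆ Ioo a b ∧ ∀ x, x ∉ K → deriv Θ0 x = 0

/-- Classical solution of the regularized problem (P_ε), of class
`C^{4,1} × C^{2,1} × C^{2,1}(Ω̄ × [0,∞))`, with positive temperature. -/
structure IsClassicalSolEps (a b : ℝ) (f : ℝ → ℝ) (ε : ℝ) (v0 u0 Θ0 : ℝ → ℝ)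
    (v u Θ : ℝ → ℝ → ℝ) : Prop where
  diffx_v : ∀ k < 4, ∀ x ∈ Icc a b, ∀ t ∈ Ici (0 : ℝ),
    DifferentiableAt ℝ (fun y => pdx^[k] v y t) x
  difft_v : ∀ x ∈ Icc a b, ∀ t ∈ Ici (0 : ℝ), DifferentiableAt ℝ (fun s => v x s) t
  cont_v : ∀ k ≤ 4, ContinuousOn (uncurry (pdx^[k] v)) ((Icc a b) ×ˢ (Ici 0))
  contt_v : ContinuousOn (uncurry (pdt v)) ((Icc a b) ×ˢ (Ici 0))
  diffx_u : ∀ k < 2, ∀ x ∈ Icc a b, ∀ t ∈ Ici (0 : ℝ),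
    DifferentiableAt ℝ (fun y => pdx^[k] u y t) x
  difft_u : ∀ x ∈ Icc a b, ∀ t ∈ Ici (0 : ℝ), DifferentiableAt ℝ (fun s => u x s) t
  cont_u : ∀ k ≤ 2, ContinuousOn (uncurry (pdx^[k] u)) ((Icc a b) ×ˢ (Ici 0))
  contt_u : ContinuousOn (uncurry (pdt u)) ((Icc a b) ×ˢ (Ici 0))
  diffx_Θ : ∀ k < 2, ∀ x ∈ Icc a b, ∀ t ∈ Ici (0 : ℝ),
    DifferentiableAt ℝ (fun y => pdx^[k] Θ y t) x
  difft_Θ : ∀ x ∈ Icc a b, ∀ t ∈ Ici (0 : ℝ), DifferentiableAt ℝ (fun s => Θ x s) t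
  cont_Θ : ∀ k ≤ 2, ContinuousOn (uncurry (pdx^[k] Θ)) ((Icc a b) ×ˢ (Ici 0))
  contt_Θ : ContinuousOn (uncurry (pdt Θ)) ((Icc a b) ×ˢ (Ici 0))
  Θ_pos : ∀ x ∈ Icc a b, ∀ t ∈ Ici (0 : ℝ), 0 < Θ x t
  eq_v : ∀ x ∈ Ioo a b, ∀ t ∈ Ioi (0 : ℝ),
    pdt v x t = -ε * pdx^[4] v x t + pdx^[2] u x t - pdx (fun y s => f (Θ y s)) x t
  eq_u : ∀ x ∈ Ioo a b, ∀ t ∈ Ioi (0 : ℝ), pdt u x t = ε * pdx^[2] u x t + v x t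
  eq_Θ : ∀ x ∈ Ioo a b, ∀ t ∈ Ioi (0 : ℝ),
    pdt Θ x t = pdx^[2] Θ x t - f (Θ x t) * pdx v x t
  bc_v : ∀ t ∈ Ioi (0 : ℝ),
    v a t = 0 ∧ v b t = 0 ∧ pdx^[2] v a t = 0 ∧ pdx^[2] v b t = 0
  bc_u : ∀ t ∈ Ioi (0 : ℝ), u a t = 0 ∧ u b t = 0
  bc_Θ : ∀ t ∈ Ioi (0 : ℝ), pdx Θ a t = 0 ∧ pdx Θ b t = 0
  init : ∀ x ∈ Icc a b, v x 0 = v0 x ∧ u x 0 = u0 x ∧ Θ x 0 = Θ0 x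

/-- Weak convergence in `L²_loc(Ω̄ × [0,∞))`. -/
def WkL2loc (a b : ℝ) (wj : ℕ → ℝ → ℝ → ℝ) (w : ℝ → ℝ → ℝ) : Prop :=
  ∀ T > (0 : ℝ), ∀ ψ : ℝ → ℝ → ℝ,
    AEStronglyMeasurable (fun p : ℝ × ℝ => ψ p.1 p.2)
      (volume.restrict ((Icc a b) ×ˢ (Icc 0 T))) →
    IntegrableOn (fun p : ℝ × ℝ => (ψ p.1 p.2) ^ 2) ((Icc a b) ×ˢ (Icc 0 T)) →
    Tendsto (fun j => ∫ p in (Icc a b) ×ˢ (Icc 0 T), wj j p.1 p.2 * ψ p.1 p.2) atTop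
      (nhds (∫ p in (Icc a b) ×ˢ (Icc 0 T), w p.1 p.2 * ψ p.1 p.2))

/-! ### Primitives of integrable functions on `[0,T]` -/

/-- `P` is a primitive of the integrable function `p` on `[0,T]`. -/
def IsPrimOn (T : ℝ) (P p : ℝ → ℝ) : Prop :=
  IntervalIntegrable p volume 0 T ∧ ∀ t ∈ Icc 0 T, P t = P 0 + ∫ s in (0 : ℝ)..t, p s

lemma IsPrimOn.continuousOn {T : ℝ} (hT : 0 ≤ T) {P p : ℝ → ℝ} (h : IsPrimOn T P p) :
    ContinuousOn P (Icc 0 T) := by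
  have hac := h.1.absolutelyContinuousOnInterval_intervalIntegral (c := 0) (by simp)
  have hc := hac.continuousOn
  rw [uIcc_of_le hT] at hc
  exact (continuousOn_const.add hc).congr h.2

lemma IsPrimOn.mono {T t : ℝ} (ht : t ∈ Icc 0 T) {P p : ℝ → ℝ} (h : IsPrimOn T P p) :
    IsPrimOn t P p := by
  refine ⟨h.1.mono_set ?_, fun s hs => h.2 s ⟨hs.1, hs.2.trans ht.2⟩⟩
  rw [uIcc_of_le ht.1, uIcc_of_le (ht.1.trans ht.2)]
  exact Icc_subset_Icc_right ht.2

lemma IsPrimOn.integral_mul {T : ℝ} (hT : 0 ≤ T) {P p Q q : ℝ → ℝ} (hP : IsPrimOn T P p)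
    (hQ : IsPrimOn T Q q) :
    ∫ s in (0 : ℝ)..T, (p s * Q s + P s * q s) = P T * Q T - P 0 * Q 0 := by
  have key : ∀ {P p : ℝ → ℝ}, IsPrimOn T P p → ∃ P' : ℝ → ℝ,
      AbsolutelyContinuousOnInterval P' 0 T ∧ (∀ s ∈ Icc 0 T, P' s = P s) ∧
      ∀ᵐ s, s ∈ uIcc 0 T → deriv P' s = p s := by
    intro P p h
    have hac := h.1.absolutelyContinuousOnInterval_intervalIntegral (c := 0) (by simp)
    have hcst : AbsolutelyContinuousOnInterval (fun _ : ℝ => P 0) 0 T :=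
      (LipschitzWith.const (P 0)).lipschitzOnWith.absolutelyContinuousOnInterval
    refine ⟨fun s => P 0 + ∫ v in (0 : ℝ)..s, p v, hcst.fun_add hac,
      fun s hs => (h.2 s hs).symm, ?_⟩
    filter_upwards [h.1.ae_hasDerivAt_integral] with s hs hs'
    exact ((hs hs' 0 (by simp)).const_add (P 0)).deriv
  obtain ⟨P', hP1, hP2, hP3⟩ := key hP
  obtain ⟨Q', hQ1, hQ2, hQ3⟩ := key hQ
  rw [← hP2 T ⟨hT, le_rfl⟩, ← hQ2 T ⟨hT, le_rfl⟩, ← hP2 0 ⟨le_rfl, hT⟩, ← hQ2 0 ⟨le_rfl, hT⟩,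
    ← hP1.integral_deriv_mul_eq_sub hQ1]
  apply intervalIntegral.integral_congr_ae
  filter_upwards [hP3, hQ3] with s h1 h2 hs
  have hs' := uIoc_subset_uIcc hs
  rw [h1 hs', h2 hs']
  rw [uIcc_of_le hT] at hs'
  rw [hP2 s hs', hQ2 s hs']

lemma isPrimOn_of_contDiff (T : ℝ) {η : ℝ → ℝ} (h : ContDiff ℝ (⊤ : ℕ∞) η) :
    IsPrimOn T η (deriv η) := by
  have hc : Continuous (deriv η) := h.continuous_deriv (by simp)
  refine ⟨hc.intervalIntegrable _ _, fun t _ => ?_⟩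
  rw [intervalIntegral.integral_deriv_eq_sub (fun x _ => h.differentiable (by simp) x)
    (hc.intervalIntegrable _ _)]
  ring

lemma setIntegral_Ioo_eq_interval {T : ℝ} (hT : 0 ≤ T) (F : ℝ → ℝ) :
    ∫ t in Ioo 0 T, F t = ∫ t in (0 : ℝ)..T, F t := by
  rw [intervalIntegral.integral_of_le hT, integral_Ioc_eq_integral_Ioo]

/-- Integration by parts against a smooth function vanishing at `T`. -/
lemma IsPrimOn.integral_mul_deriv {T : ℝ} (hT : 0 ≤ T) {P p η : ℝ → ℝ} (hP : IsPrimOn T P p)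
    (h : ContDiff ℝ (⊤ : ℕ∞) η) (hηT : η T = 0) :
    ∫ s in Ioo 0 T, P s * deriv η s = - P 0 * η 0 - ∫ s in Ioo 0 T, p s * η s := by
  have hη := isPrimOn_of_contDiff T h
  have hm := hP.integral_mul hT hη
  rw [intervalIntegral.integral_add, hηT] at hm
  · rw [setIntegral_Ioo_eq_interval hT, setIntegral_Ioo_eq_interval hT]
    linarith
  · exact hP.1.mul_continuousOn h.continuous.continuousOn
  · exact hη.1.continuousOn_mul (by rw [uIcc_of_le hT]; exact hP.continuousOn hT)

/-- Smooth functions of time with compact support in `(0,T)`. -/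
def TimeTest (T : ℝ) (η : ℝ → ℝ) : Prop :=
  ContDiff ℝ (⊤ : ℕ∞) η ∧ ∃ α β : ℝ, 0 < α ∧ β < T ∧ ∀ t, t ∉ Icc α β → η t = 0

lemma exists_Icc_of_tsupport {T : ℝ} (hT : 0 < T) {g : ℝ → ℝ} (hg : HasCompactSupport g)
    (hs : tsupport g ⊆ Ioo 0 T) :
    ∃ α β : ℝ, 0 < α ∧ β < T ∧ ∀ t, t ∉ Icc α β → g t = 0 := by
  have hK : IsCompact (insert (T / 2) (tsupport g)) := hg.isCompact.insert _
  have hne : (insert (T / 2) (tsupport g)).Nonempty := ⟨_, mem_insert _ _⟩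
  have hsub : insert (T / 2) (tsupport g) ⊆ Ioo 0 T :=
    insert_subset ⟨by linarith, by linarith⟩ hs
  refine ⟨_, _, (hsub (hK.sInf_mem hne)).1, (hsub (hK.sSup_mem hne)).2, fun t ht => ?_⟩
  by_contra h
  have hm : t ∈ insert (T / 2) (tsupport g) := mem_insert_of_mem _ (subset_tsupport _ h)
  exact ht ⟨csInf_le hK.bddBelow hm, le_csSup hK.bddAbove hm⟩

lemma contDiff_primitive {ξ : ℝ → ℝ} (h : ContDiff ℝ (⊤ : ℕ∞) ξ) :
    ContDiff ℝ (⊤ : ℕ∞) (fun t => ∫ s in (0 : ℝ)..t, ξ s) ∧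
      deriv (fun t => ∫ s in (0 : ℝ)..t, ξ s) = ξ := by
  have hd : ∀ t, HasDerivAt (fun t => ∫ s in (0 : ℝ)..t, ξ s) (ξ t) t := fun t =>
    h.continuous.integral_hasStrictDerivAt 0 t |>.hasDerivAt
  have hd' : deriv (fun t => ∫ s in (0 : ℝ)..t, ξ s) = ξ := funext fun t => (hd t).deriv
  refine ⟨contDiff_infty_iff_deriv.2 ⟨fun t => (hd t).differentiableAt, ?_⟩, hd'⟩
  rwa [hd']

lemma integral_eq_zero_of_vanish {F : ℝ → ℝ} {c d : ℝ} (h : ∀ s ∈ uIcc c d, F s = 0) :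
    ∫ s in c..d, F s = 0 := by
  rw [intervalIntegral.integral_congr (g := fun _ => 0) h]; simp

/-- Smooth functions with compact support in `(0,T)` and mean zero have a compactly supported
primitive. -/
lemma timeTest_primitive {T : ℝ} {ξ : ℝ → ℝ} (h : TimeTest T ξ)
    (h0 : ∫ s in (0 : ℝ)..T, ξ s = 0) : TimeTest T (fun t => ∫ s in (0 : ℝ)..t, ξ s) := by
  obtain ⟨hc, α, β, hα, hβ, hv⟩ := h
  refine ⟨(contDiff_primitive hc).1, α, β, hα, hβ, fun t ht => ?_⟩
  rcases lt_or_ge t α with h1 | h1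
  · apply integral_eq_zero_of_vanish
    intro s hs
    apply hv
    have := hs.2
    have : s < α := this.trans_lt (by simp [hα, h1])
    exact fun h => absurd h.1 (not_le.2 this)
  · have h2 : β < t := by
      by_contra h2
      exact ht ⟨h1, not_lt.1 h2⟩
    have hi := fun x y => hc.continuous.intervalIntegrable (μ := volume) x y
    have := intervalIntegral.integral_add_adjacent_intervals (hi 0 T) (hi T t)
    beta_reduce
    rw [← this, h0, zero_add]
    apply integral_eq_zero_of_vanish
    intro s hs
    apply hv
    have : β < s := (lt_inf_iff.2 ⟨hβ, h2⟩).trans_le hs.1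
    exact fun h => absurd h.2 (not_le.2 this)

lemma exists_timeTest_integral_one {T : ℝ} (hT : 0 < T) :
    ∃ ζ, TimeTest T ζ ∧ ∫ s in (0 : ℝ)..T, ζ s = 1 := by
  let B : ContDiffBump (T / 2) := ⟨T / 8, T / 4, by positivity, by linarith⟩
  have hs : tsupport (B.normed volume) ⊆ Ioo 0 T := by
    rw [B.tsupport_normed_eq]
    intro x hx
    rw [Real.closedBall_eq_Icc] at hx
    have h1 := hx.1
    have h2 := hx.2
    simp only [B] at h1 h2
    exact ⟨by linarith, by linarith⟩
  refine ⟨B.normed volume, ⟨B.contDiff_normed,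
    exists_Icc_of_tsupport hT B.hasCompactSupport_normed hs⟩, ?_⟩
  rw [← setIntegral_Ioo_eq_interval hT.le, setIntegral_eq_integral_of_forall_compl_eq_zero,
    B.integral_normed]
  intro x hx
  by_contra h
  exact hx (hs (subset_tsupport _ h))

/-- The lemma of du Bois-Reymond: a continuous function with integrable weak derivative
is a primitive of it. -/
lemma isPrimOn_of_weak {T : ℝ} (hT : 0 < T) {F G : ℝ → ℝ} (hF : ContinuousOn F (Icc 0 T))
    (hG : IntegrableOn G (Ioo 0 T))
    (h : ∀ η, TimeTest T η →
      ∫ s in Ioo 0 T, F s * deriv η s = - ∫ s in Ioo 0 T, G s * η s) :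
    IsPrimOn T F G := by
  have hGi : IntervalIntegrable G volume 0 T := by
    rw [intervalIntegrable_iff_integrableOn_Ioo_of_le hT.le]; exact hG
  refine ⟨hGi, ?_⟩
  set P : ℝ → ℝ := fun t => ∫ s in (0 : ℝ)..t, G s with hPdef
  have hP : IsPrimOn T P G := ⟨hGi, fun t _ => by simp [hPdef]⟩
  have hPc := hP.continuousOn hT.le
  set R : ℝ → ℝ := fun t => F t - P t with hR
  have hRc : ContinuousOn R (Icc 0 T) := hF.sub hPc
  have ii : ∀ {U V : ℝ → ℝ}, ContinuousOn U (Icc 0 T) → Continuous V →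
      IntervalIntegrable (fun s => U s * V s) volume 0 T := fun hU hV =>
    ContinuousOn.intervalIntegrable (by
      rw [uIcc_of_le hT.le]; exact hU.mul hV.continuousOn)
  have h1 : ∀ η, TimeTest T η → ∫ s in (0 : ℝ)..T, R s * deriv η s = 0 := by
    intro η hη
    have hη' := hη
    obtain ⟨hc, α, β, hα, hβ, hv⟩ := hη'
    have e1 := h η hη
    have e2 := hP.integral_mul_deriv hT.le hc (hv T fun h => absurd h.2 (not_le.2 hβ))
    have e3 : P 0 = 0 := by simp [hPdef]
    rw [setIntegral_Ioo_eq_interval hT.le, setIntegral_Ioo_eq_interval hT.le] at e1 e2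
    have hdc : Continuous (deriv η) := hc.continuous_deriv (by simp)
    simp only [hR, sub_mul]
    rw [intervalIntegral.integral_sub (ii hF hdc) (ii hPc hdc), e1, e2, e3]
    ring
  obtain ⟨ζ₀, hζ₀, hζ₀1⟩ := exists_timeTest_integral_one hT
  set k := ∫ s in (0 : ℝ)..T, R s * ζ₀ s with hk
  have h2 : ∀ ζ, TimeTest T ζ → ∫ s in (0 : ℝ)..T, (R s - k) * ζ s = 0 := by
    intro ζ hζ
    set m := ∫ s in (0 : ℝ)..T, ζ s with hm
    have hζi := hζ.1.continuous.intervalIntegrable (μ := volume) 0 T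
    have hζ₀i := hζ₀.1.continuous.intervalIntegrable (μ := volume) 0 T
    have ht : TimeTest T (fun s => ζ s - m * ζ₀ s) := by
      obtain ⟨c1, α1, β1, hα1, hβ1, v1⟩ := hζ
      obtain ⟨c2, α2, β2, hα2, hβ2, v2⟩ := hζ₀
      refine ⟨c1.sub (contDiff_const.mul c2), min α1 α2, max β1 β2, lt_min hα1 hα2,
        max_lt hβ1 hβ2, fun t ht => ?_⟩
      beta_reduce
      rw [v1 t fun h => ht ⟨(min_le_left _ _).trans h.1, h.2.trans (le_max_left _ _)⟩,
        v2 t fun h => ht ⟨(min_le_right _ _).trans h.1, h.2.trans (le_max_right _ _)⟩]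
      simp
    have ht0 : ∫ s in (0 : ℝ)..T, (ζ s - m * ζ₀ s) = 0 := by
      rw [intervalIntegral.integral_sub hζi (hζ₀i.const_mul m),
        intervalIntegral.integral_const_mul, hζ₀1]
      simp [hm]
    have e := h1 _ (timeTest_primitive ht ht0)
    rw [(contDiff_primitive ht.1).2] at e
    have e2 : ∀ s, R s * (ζ s - m * ζ₀ s) = R s * ζ s - m * (R s * ζ₀ s) := fun s => by ring
    simp only [e2] at e
    rw [intervalIntegral.integral_sub (ii hRc hζ.1.continuous)
      ((ii hRc hζ₀.1.continuous).const_mul m), intervalIntegral.integral_const_mul] at e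
    simp only [sub_mul]
    rw [intervalIntegral.integral_sub (ii hRc hζ.1.continuous) (hζi.const_mul k),
      intervalIntegral.integral_const_mul]
    linarith
  have h3 : ∀ᵐ t, t ∈ Ioo 0 T → R t - k = 0 := by
    apply isOpen_Ioo.ae_eq_zero_of_integral_contDiff_smul_eq_zero
    · exact ((hRc.sub continuousOn_const).mono Ioo_subset_Icc_self).locallyIntegrableOn
        measurableSet_Ioo
    · intro g hg hgc hgs
      rw [← h2 g ⟨hg, exists_Icc_of_tsupport hT hgc hgs⟩, ← setIntegral_Ioo_eq_interval hT.le,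
        setIntegral_eq_integral_of_forall_compl_eq_zero]
      · simp only [smul_eq_mul, mul_comm]
      · intro x hx
        have : g x = 0 := by
          by_contra h
          exact hx (hgs (subset_tsupport _ h))
        rw [this, mul_zero]
  have h4 : EqOn R (fun _ => k) (Icc 0 T) := by
    have : EqOn R (fun _ => k) (Ioo 0 T) := by
      refine Measure.eqOn_open_of_ae_eq (μ := volume) ?_ isOpen_Ioo
        (hRc.mono Ioo_subset_Icc_self) continuousOn_const
      rw [EventuallyEq, ae_restrict_iff' measurableSet_Ioo]
      filter_upwards [h3] with t ht ht'
      linarith [ht ht']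
    refine this.of_subset_closure hRc continuousOn_const Ioo_subset_Icc_self ?_
    rw [closure_Ioo hT.ne]
  intro t ht
  have e0 : R 0 = k := h4 ⟨le_rfl, hT.le⟩
  have et : R t = k := h4 ht
  have e3 : P 0 = 0 := by simp [hPdef]
  change F t = F 0 + P t
  simp only [hR] at e0 et
  linarith

/-! ### Parseval identities for the sine and cosine systems on `(a,b)` -/

/-- The frequencies `n π / (b - a)`. -/
def freq (a b : ℝ) (n : ℤ) : ℝ := n * Real.pi / (b - a)

/-- The sine modes on `(a,b)`. -/
def sinM (a b : ℝ) (n : ℤ) (x : ℝ) : ℝ := Real.sin (freq a b n * (x - a))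

/-- The cosine modes on `(a,b)`. -/
def cosM (a b : ℝ) (n : ℤ) (x : ℝ) : ℝ := Real.cos (freq a b n * (x - a))

lemma memL2_iff {a b : ℝ} {g : ℝ → ℝ} : MemL2 a b g ↔ MemLp g 2 (volume.restrict (Ioo a b)) := by
  constructor
  · rintro ⟨h1, h2⟩
    exact (memLp_two_iff_integrable_sq h1).2 h2
  · intro h
    exact ⟨h.1, (memLp_two_iff_integrable_sq h.1).1 h⟩

lemma HasSum.congr_of_eq {ι : Type*} {p q : ι → ℝ} {s t : ℝ} (h : HasSum p s)
    (hpq : ∀ n, q n = p n) (hst : t = s) : HasSum q t := by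
  rw [funext hpq, hst]; exact h

/-- Parseval's identity for the extension of `g` from `(a,b)` to `(2a-b,b)` with parity `σ`. -/
lemma parseval_reflect {a b : ℝ} (hab : a < b) {g : ℝ → ℝ}
    (hg : MemLp g 2 (volume.restrict (Ioo a b))) {σ : ℝ} (hσ : σ ^ 2 = 1) :
    HasSum (fun n : ℤ => ‖∫ x in Ioo a b,
        (Complex.exp (-(Complex.I * freq a b n * (x - a)))
          + σ * Complex.exp (Complex.I * freq a b n * (x - a))) * g x‖ ^ 2)
      (4 * ((b - a) * ∫ x in Ioo a b, (g x) ^ 2)) := by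
  set g0 : ℝ → ℝ := (Ioo a b).indicator g with hg0
  have hg0L : MemLp g0 2 volume := (memLp_indicator_iff_restrict measurableSet_Ioo).2 hg
  have hrefl : MeasurePreserving (fun x : ℝ => 2 * a - x) volume volume :=
    Measure.measurePreserving_sub_left volume (2 * a)
  have hg1L : MemLp (fun x => g0 (2 * a - x)) 2 volume := hg0L.comp_measurePreserving hrefl
  have hAB : 2 * a - b < b := by linarith
  have hL : (0 : ℝ) < b - a := by linarith
  set G : ℝ → ℂ := fun x => ((g0 x + σ * g0 (2 * a - x) : ℝ) : ℂ) with hG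
  have hGL : MemLp G 2 (volume.restrict (Ioc (2 * a - b) b)) :=
    ((hg0L.add (hg1L.const_mul σ)).ofReal (K := ℂ)).restrict _
  have hP := hasSum_sq_fourierCoeffOn hAB hGL
  have hfin : IsFiniteMeasure (volume.restrict (Ioo a b)) := ⟨by simp⟩
  have hgi : Integrable g (volume.restrict (Ioo a b)) := hg.integrable (by norm_num)
  have hg0i : Integrable g0 volume := (integrable_indicator_iff measurableSet_Ioo).2 hgi
  have hcompl : ∀ x, x ∉ Ioo a b → g0 x = 0 := fun x hx => indicator_of_notMem hx _
  have hsub : Ioo a b ⊆ Ioc (2 * a - b) b := fun x hx => ⟨by linarith [hx.1], hx.2.le⟩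
  -- integrals against `g0` over the doubled interval
  have hint : ∀ F : ℝ → ℂ, ∫ x in (2 * a - b)..b, F x * g0 x = ∫ x in Ioo a b, F x * g x := by
    intro F
    rw [intervalIntegral.integral_of_le hAB.le]
    rw [setIntegral_eq_of_subset_of_forall_sdiff_eq_zero measurableSet_Ioc hsub]
    · refine setIntegral_congr_fun measurableSet_Ioo fun x hx => ?_
      simp only [hg0, indicator_of_mem hx]
    · intro x hx
      simp [hcompl x hx.2]
  have hint2 : ∀ F : ℝ → ℂ, ∫ x in (2 * a - b)..b, F x * g0 (2 * a - x)
      = ∫ x in Ioo a b, F (2 * a - x) * g x := by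
    intro F
    have := intervalIntegral.integral_comp_sub_left (a := 2 * a - b) (b := b)
      (fun x => F (2 * a - x) * (g0 x : ℂ)) (2 * a)
    simp only [sub_sub_cancel] at this
    rw [this, hint (fun x => F (2 * a - x))]
  have hsq : ∫ x in (2 * a - b)..b, ‖G x‖ ^ 2 = 2 * ∫ x in Ioo a b, (g x) ^ 2 := by
    have e : ∀ x, ((‖G x‖ ^ 2 : ℝ) : ℂ) = (g0 x : ℂ) * g0 x
        + (g0 (2 * a - x) : ℂ) * g0 (2 * a - x) := by
      intro x
      have h0 : g0 x * g0 (2 * a - x) = 0 := by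
        by_cases hx : x ∈ Ioo a b
        · rw [hcompl (2 * a - x), mul_zero]
          intro h; linarith [h.1, hx.1]
        · rw [hcompl x hx, zero_mul]
      have : ‖G x‖ ^ 2 = g0 x * g0 x + g0 (2 * a - x) * g0 (2 * a - x) := by
        simp only [hG, Complex.norm_real, Real.norm_eq_abs, sq_abs]
        linear_combination 2 * σ * h0 + g0 (2 * a - x) ^ 2 * hσ
      rw [this]; push_cast; ring
    have hii : ∀ {h : ℝ → ℝ}, MemLp h 2 volume →
        IntervalIntegrable (fun x => (h x : ℂ) * h x) volume (2 * a - b) b := by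
      intro h hh
      have := hh.integrable_sq.ofReal (𝕜 := ℂ)
      refine (this.congr (ae_of_all _ fun x => ?_)).intervalIntegrable
      simp [sq]
    have : ((∫ x in (2 * a - b)..b, ‖G x‖ ^ 2 : ℝ) : ℂ)
        = ((2 * ∫ x in Ioo a b, (g x) ^ 2 : ℝ) : ℂ) := by
      rw [← intervalIntegral.integral_ofReal]
      simp only [e]
      rw [intervalIntegral.integral_add (hii hg0L) (hii hg1L), hint, hint2]
      have : ∀ x ∈ Ioo a b, (g0 (2 * a - (2 * a - x)) : ℂ) * g x = ((g x ^ 2 : ℝ) : ℂ) := by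
        intro x hx
        simp only [sub_sub_cancel, hg0, indicator_of_mem hx]
        push_cast; ring
      rw [setIntegral_congr_fun measurableSet_Ioo this]
      have : ∀ x ∈ Ioo a b, (g0 x : ℂ) * g x = ((g x ^ 2 : ℝ) : ℂ) := by
        intro x hx
        simp only [hg0, indicator_of_mem hx]
        push_cast; ring
      rw [setIntegral_congr_fun measurableSet_Ioo this, integral_complex_ofReal]
      push_cast; ring
    exact_mod_cast this
  rw [hsq] at hP
  have hP2 := hP.mul_left ((2 * (b - a)) ^ 2)
  have hval : (2 * (b - a)) ^ 2 * ((b - (2 * a - b))⁻¹ • (2 * ∫ x in Ioo a b, (g x) ^ 2))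
      = 4 * ((b - a) * ∫ x in Ioo a b, (g x) ^ 2) := by
    have : b - (2 * a - b) = 2 * (b - a) := by ring
    rw [this, smul_eq_mul]
    field_simp
    ring
  rw [hval] at hP2
  refine hP2.congr_of_eq (fun n => ?_) rfl
  set E : ℝ → ℂ := fun x => Complex.exp (-(Complex.I * freq a b n * x)) with hE
  have hEc : Continuous E := by fun_prop
  have hfour : ∀ x : ℝ, fourier (-n) (x : AddCircle (b - (2 * a - b))) = E x := by
    intro x
    rw [fourier_coe_apply, hE]
    congr 1
    have h2 : (b : ℂ) - a ≠ 0 := by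
      rw [← Complex.ofReal_sub]; exact_mod_cast hL.ne'
    have h3 : (b : ℂ) - (2 * a - b) ≠ 0 := by
      have : (b : ℂ) - (2 * a - b) = 2 * (b - a) := by ring
      rw [this]; exact mul_ne_zero two_ne_zero h2
    simp only [freq]
    push_cast
    field_simp
    ring
  have hbd : ∀ {h : ℝ → ℝ}, Integrable h volume → ∀ F : ℝ → ℂ, Continuous F →
      IntervalIntegrable (fun x => F x * (h x : ℂ)) volume (2 * a - b) b := by
    intro h hh F hF
    exact hh.ofReal.intervalIntegrable.continuousOn_mul hF.continuousOn
  have hEg : ∀ F : ℝ → ℂ, Continuous F →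
      Integrable (fun x => F x * (g x : ℂ)) (volume.restrict (Ioo a b)) := by
    intro F hF
    have : IntegrableOn (fun x => F x * (g0 x : ℂ)) (Ioo a b) := by
      have := (hbd hg0i F hF).1
      exact this.mono_set hsub
    refine this.congr ?_
    filter_upwards [ae_restrict_mem measurableSet_Ioo] with x hx
    simp only [hg0, indicator_of_mem hx]
  have hc : fourierCoeffOn hAB G n = ((2 * (b - a) : ℝ) : ℂ)⁻¹
      * (Complex.exp (-(Complex.I * freq a b n * a))
      * ∫ x in Ioo a b, (Complex.exp (-(Complex.I * freq a b n * (x - a)))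
          + σ * Complex.exp (Complex.I * freq a b n * (x - a))) * g x) := by
    rw [fourierCoeffOn_eq_integral]
    have e1 : ∀ x : ℝ, fourier (-n) (x : AddCircle (b - (2 * a - b))) • G x
        = E x * (g0 x : ℂ) + (σ * E x) * (g0 (2 * a - x) : ℂ) := by
      intro x
      rw [hfour, hG, smul_eq_mul]; push_cast; ring
    simp only [e1]
    have hEc2 : Continuous fun x => (σ : ℂ) * E (2 * a - x) := by fun_prop
    rw [intervalIntegral.integral_add (hbd hg0i E hEc)
      (hbd (hg0i.comp_sub_left (2 * a)) (fun x => σ * E x) (continuous_const.mul hEc)), hint E,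
      hint2 (fun x => (σ : ℂ) * E x), ← integral_add (hEg E hEc) (hEg _ hEc2),
      ← integral_const_mul]
    rw [Complex.real_smul]
    congr 1
    · rw [one_div, ← Complex.ofReal_inv]
      congr 2
      ring
    · congr 1
      ext x
      have h1 : E x = Complex.exp (-(Complex.I * freq a b n * a))
          * Complex.exp (-(Complex.I * freq a b n * (x - a))) := by
        simp only [hE, ← Complex.exp_add]; congr 1; ring
      have h2 : E (2 * a - x) = Complex.exp (-(Complex.I * freq a b n * a))
          * Complex.exp (Complex.I * freq a b n * (x - a)) := by
        simp only [hE, ← Complex.exp_add]; congr 1; push_cast; ring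
      rw [h1, h2]; ring
  have hn : ‖Complex.exp (-(Complex.I * freq a b n * a))‖ = 1 := by
    have : -(Complex.I * freq a b n * a) = ((-(freq a b n * a) : ℝ) : ℂ) * Complex.I := by
      push_cast; ring
    rw [this, Complex.norm_exp_ofReal_mul_I]
  rw [hc, norm_mul, norm_mul, hn, norm_inv, Complex.norm_real, Real.norm_eq_abs,
    abs_of_pos (by linarith)]
  field_simp

lemma parseval_cos {a b : ℝ} (hab : a < b) {g : ℝ → ℝ} (hg : MemL2 a b g) :
    HasSum (fun n : ℤ => (∫ x in Ioo a b, g x * cosM a b n x) ^ 2)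
      ((b - a) * ∫ x in Ioo a b, (g x) ^ 2) := by
  have h := (parseval_reflect hab (memL2_iff.1 hg) (σ := 1) (by norm_num)).mul_left (1 / 4)
  rw [← mul_assoc, show (1 / 4 : ℝ) * 4 = 1 by norm_num, one_mul] at h
  refine h.congr_of_eq (fun n => ?_) rfl
  have e : ∀ x : ℝ, (Complex.exp (-(Complex.I * freq a b n * (x - a)))
      + (1 : ℝ) * Complex.exp (Complex.I * freq a b n * (x - a))) * g x
      = ((2 * (g x * cosM a b n x) : ℝ) : ℂ) := by
    intro x
    simp only [cosM]
    push_cast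
    rw [Complex.cos]
    ring_nf
  simp only [e]
  rw [integral_complex_ofReal, Complex.norm_real, integral_const_mul, Real.norm_eq_abs, sq_abs]
  ring

lemma parseval_sin {a b : ℝ} (hab : a < b) {g : ℝ → ℝ} (hg : MemL2 a b g) :
    HasSum (fun n : ℤ => (∫ x in Ioo a b, g x * sinM a b n x) ^ 2)
      ((b - a) * ∫ x in Ioo a b, (g x) ^ 2) := by
  have h := (parseval_reflect hab (memL2_iff.1 hg) (σ := -1) (by norm_num)).mul_left (1 / 4)
  rw [← mul_assoc, show (1 / 4 : ℝ) * 4 = 1 by norm_num, one_mul] at h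
  refine h.congr_of_eq (fun n => ?_) rfl
  have e : ∀ x : ℝ, (Complex.exp (-(Complex.I * freq a b n * (x - a)))
      + (-1 : ℝ) * Complex.exp (Complex.I * freq a b n * (x - a))) * g x
      = (-Complex.I) * ((2 * (g x * sinM a b n x) : ℝ) : ℂ) := by
    intro x
    simp only [sinM]
    push_cast
    rw [Complex.sin]
    ring_nf
    simp only [Complex.I_sq]
    ring
  simp only [e]
  rw [integral_const_mul, integral_complex_ofReal, norm_mul, norm_neg, Complex.norm_I, one_mul,
    Complex.norm_real, integral_const_mul, Real.norm_eq_abs, sq_abs]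
  ring

lemma parseval_sin_mul {a b : ℝ} (hab : a < b) {g h : ℝ → ℝ} (hg : MemL2 a b g)
    (hh : MemL2 a b h) :
    HasSum (fun n : ℤ => (∫ x in Ioo a b, g x * sinM a b n x) * ∫ x in Ioo a b, h x * sinM a b n x)
      ((b - a) * ∫ x in Ioo a b, g x * h x) := by
  rw [memL2_iff] at hg hh
  have hfin : IsFiniteMeasure (volume.restrict (Ioo a b)) := ⟨by simp⟩
  have hi : ∀ {k : ℝ → ℝ}, MemLp k 2 (volume.restrict (Ioo a b)) → ∀ n,
      Integrable (fun x => k x * sinM a b n x) (volume.restrict (Ioo a b)) := by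
    intro k hk n
    refine (hk.integrable (by norm_num)).mul_bdd (c := 1) ?_ (ae_of_all _ fun x => ?_)
    · exact (by unfold sinM; fun_prop : Continuous (sinM a b n)).aestronglyMeasurable
    · exact Real.abs_sin_le_one _
  have h1 := parseval_sin hab (memL2_iff.2 (hg.add hh))
  have h2 := parseval_sin hab (memL2_iff.2 (hg.sub hh))
  have h3 := (h1.sub h2).mul_left (1 / 4)
  have hgh := hg.integrable_mul hh
  refine h3.congr_of_eq (fun n => ?_) ?_
  · simp only [Pi.add_apply, Pi.sub_apply, add_mul, sub_mul]
    rw [integral_add (hi hg n) (hi hh n), integral_sub (hi hg n) (hi hh n)]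
    ring
  · rw [← mul_sub, ← integral_sub (hg.add hh).integrable_sq (hg.sub hh).integrable_sq]
    have : ∀ x, (g x + h x) ^ 2 - (g x - h x) ^ 2 = 4 * (g x * h x) := fun x => by ring
    simp only [Pi.add_apply, Pi.sub_apply, this]
    rw [integral_const_mul]
    ring

/-! ### Cutoffs near the end points of `(a,b)` -/

/-- A smooth step, equal to `0` on `(-∞,1]` and to `1` on `[2,∞)`. -/
def stepFn (y : ℝ) : ℝ := Real.smoothTransition (y - 1)

lemma stepFn_contDiff : ContDiff ℝ (⊤ : ℕ∞) stepFn :=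
  Real.smoothTransition.contDiff.comp (contDiff_id.sub contDiff_const)

lemma abs_stepFn_le (y : ℝ) : |stepFn y| ≤ 1 := by
  unfold stepFn
  rw [abs_of_nonneg (Real.smoothTransition.nonneg _)]
  exact Real.smoothTransition.le_one _

lemma stepFn_eq_zero {y : ℝ} (h : y ≤ 1) : stepFn y = 0 :=
  Real.smoothTransition.zero_of_nonpos (by linarith)

lemma stepFn_eq_one {y : ℝ} (h : 2 ≤ y) : stepFn y = 1 :=
  Real.smoothTransition.one_of_one_le (by linarith)

lemma exists_bound_mul_deriv_stepFn : ∃ M : ℝ, 0 ≤ M ∧ ∀ y, |y * deriv stepFn y| ≤ M := by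
  have hc : Continuous (fun y => y * deriv stepFn y) :=
    continuous_id.mul (stepFn_contDiff.continuous_deriv (by simp))
  have hs : HasCompactSupport (fun y => y * deriv stepFn y) := by
    refine HasCompactSupport.intro (isCompact_Icc (a := (1 : ℝ)) (b := 2)) fun y hy => ?_
    have : deriv stepFn y = 0 := by
      rcases lt_or_ge y 1 with h | h
      · have : stepFn =ᶠ[nhds y] fun _ => 0 := by
          filter_upwards [Iio_mem_nhds h] with z hz using stepFn_eq_zero (le_of_lt hz)
        rw [this.deriv_eq]; simp
      · have h2 : 2 < y := by
          by_contra h2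
          exact hy ⟨h, not_lt.1 h2⟩
        have : stepFn =ᶠ[nhds y] fun _ => 1 := by
          filter_upwards [Ioi_mem_nhds h2] with z hz using stepFn_eq_one (le_of_lt hz)
        rw [this.deriv_eq]; simp
    rw [this, mul_zero]
  obtain ⟨M, hM⟩ := hs.exists_bound_of_continuous hc
  exact ⟨M, (norm_nonneg _).trans (hM 0), hM⟩

/-- Functions vanishing at the end points are limits of test functions, with uniformly bounded
derivatives. -/
lemma exists_cutoff {a b : ℝ} (hab : a < b) {ρ : ℝ → ℝ} (hρ : ContDiff ℝ (⊤ : ℕ∞) ρ)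
    (ha : ρ a = 0) (hb : ρ b = 0) :
    ∃ (C : ℝ) (r : ℕ → ℝ → ℝ), (∀ m, ContDiff ℝ (⊤ : ℕ∞) (r m)) ∧
      (∀ m, ∃ K : Set ℝ, IsCompact K ∧ K ⊆ Ioo a b ∧ ∀ x, x ∉ K → r m x = 0) ∧
      (∀ m, ∀ x ∈ Ioo a b, |r m x| ≤ C) ∧ (∀ m, ∀ x ∈ Ioo a b, |deriv (r m) x| ≤ C) ∧
      (∀ x ∈ Ioo a b, Tendsto (fun m => r m x) atTop (nhds (ρ x))) ∧
      (∀ x ∈ Ioo a b, Tendsto (fun m => deriv (r m) x) atTop (nhds (deriv ρ x))) := by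
  obtain ⟨M, hM0, hM⟩ := exists_bound_mul_deriv_stepFn
  have hρd : Continuous (deriv ρ) := hρ.continuous_deriv (by simp)
  obtain ⟨C0, hC0⟩ := isCompact_Icc.exists_bound_of_continuousOn (s := Icc a b)
    hρ.continuous.continuousOn
  obtain ⟨Λ, hΛ⟩ := isCompact_Icc.exists_bound_of_continuousOn (s := Icc a b) hρd.continuousOn
  have hΛ0 : 0 ≤ Λ := (norm_nonneg _).trans (hΛ a ⟨le_rfl, hab.le⟩)
  have hC00 : 0 ≤ C0 := (norm_nonneg _).trans (hC0 a ⟨le_rfl, hab.le⟩)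
  have hmv : ∀ x ∈ Icc a b, ∀ y ∈ Icc a b, |ρ y - ρ x| ≤ Λ * |y - x| := fun x hx y hy =>
    (convex_Icc a b).norm_image_sub_le_of_norm_deriv_le
      (fun z _ => hρ.differentiable (by simp) z) hΛ hx hy
  have hla : ∀ x ∈ Ioo a b, |ρ x| ≤ Λ * (x - a) := by
    intro x hx
    have := hmv a ⟨le_rfl, hab.le⟩ x ⟨hx.1.le, hx.2.le⟩
    rwa [ha, sub_zero, abs_of_pos (sub_pos.2 hx.1)] at this
  have hlb : ∀ x ∈ Ioo a b, |ρ x| ≤ Λ * (b - x) := by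
    intro x hx
    have := hmv b ⟨hab.le, le_rfl⟩ x ⟨hx.1.le, hx.2.le⟩
    rwa [hb, sub_zero, abs_sub_comm, abs_of_pos (sub_pos.2 hx.2)] at this
  set p : ℕ → ℝ → ℝ := fun m x => stepFn ((m + 1) * (x - a)) with hp
  set q : ℕ → ℝ → ℝ := fun m x => stepFn ((m + 1) * (b - x)) with hq
  set r : ℕ → ℝ → ℝ := fun m x => p m x * q m x * ρ x with hr
  have hpc : ∀ m, ContDiff ℝ (⊤ : ℕ∞) (p m) := fun m =>
    stepFn_contDiff.comp (contDiff_const.mul (contDiff_id.sub contDiff_const))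
  have hqc : ∀ m, ContDiff ℝ (⊤ : ℕ∞) (q m) := fun m =>
    stepFn_contDiff.comp (contDiff_const.mul (contDiff_const.sub contDiff_id))
  have hrc : ∀ m, ContDiff ℝ (⊤ : ℕ∞) (r m) := fun m => ((hpc m).mul (hqc m)).mul hρ
  have hsd : ∀ y, HasDerivAt stepFn (deriv stepFn y) y := fun y =>
    (stepFn_contDiff.differentiable (by simp) y).hasDerivAt
  have hdp : ∀ m x, HasDerivAt (p m) (deriv stepFn ((m + 1) * (x - a)) * (m + 1)) x := by
    intro m x
    have h1 : HasDerivAt (fun x : ℝ => ((m : ℝ) + 1) * (x - a)) ((m : ℝ) + 1) x := by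
      simpa using ((hasDerivAt_id x).sub_const a).const_mul ((m : ℝ) + 1)
    exact (hsd _).comp x h1
  have hdq : ∀ m x, HasDerivAt (q m) (deriv stepFn ((m + 1) * (b - x)) * (-(m + 1))) x := by
    intro m x
    have h1 : HasDerivAt (fun x : ℝ => ((m : ℝ) + 1) * (b - x)) (-((m : ℝ) + 1)) x := by
      simpa using ((hasDerivAt_id x).const_sub b).const_mul ((m : ℝ) + 1)
    exact (hsd _).comp x h1
  have hp1 : ∀ m x, |p m x| ≤ 1 := fun m x => abs_stepFn_le _
  have hq1 : ∀ m x, |q m x| ≤ 1 := fun m x => abs_stepFn_le _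
  have hloc : ∀ x ∈ Ioo a b, ∀ᶠ m : ℕ in atTop, r m =ᶠ[nhds x] ρ := by
    intro x hx
    have h1 : ∀ c : ℝ, 0 < c → ∀ᶠ m : ℕ in atTop, 2 < ((m : ℝ) + 1) * c := by
      intro c hc
      filter_upwards [eventually_gt_atTop ⌈2 / c⌉₊] with m hm
      have : 2 / c < m := (Nat.le_ceil _).trans_lt (by exact_mod_cast hm)
      rw [div_lt_iff₀ hc] at this
      nlinarith
    filter_upwards [h1 _ (sub_pos.2 hx.1), h1 _ (sub_pos.2 hx.2)] with m h2 h3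
    have c1 : Continuous fun y : ℝ => ((m : ℝ) + 1) * (y - a) := by fun_prop
    have c2 : Continuous fun y : ℝ => ((m : ℝ) + 1) * (b - y) := by fun_prop
    filter_upwards [c1.continuousAt.eventually (Ioi_mem_nhds h2),
      c2.continuousAt.eventually (Ioi_mem_nhds h3)] with y h4 h5
    simp only [hr, hp, hq]
    rw [stepFn_eq_one (le_of_lt h4), stepFn_eq_one (le_of_lt h5)]
    ring
  refine ⟨C0 + (M * Λ + M * Λ + Λ), r, hrc, fun m => ?_, fun m x hx => ?_, fun m x hx => ?_,
    fun x hx => ?_, fun x hx => ?_⟩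
  · have hm : (0 : ℝ) < m + 1 := by positivity
    refine ⟨Icc (a + 1 / (m + 1)) (b - 1 / (m + 1)), isCompact_Icc, fun x hx => ?_,
      fun x hx => ?_⟩
    · have : (0 : ℝ) < 1 / (m + 1) := by positivity
      exact ⟨by linarith [hx.1], by linarith [hx.2]⟩
    · simp only [hr, hp, hq]
      rcases lt_or_ge x (a + 1 / (m + 1)) with h | h
      · rw [stepFn_eq_zero, zero_mul, zero_mul]
        have : x - a < 1 / (m + 1) := by linarith
        rw [lt_div_iff₀ hm] at this
        linarith
      · have h2 : b - 1 / (m + 1) < x := by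
          by_contra h2
          exact hx ⟨h, not_lt.1 h2⟩
        rw [stepFn_eq_zero (y := (m + 1) * (b - x)), mul_zero, zero_mul]
        have : b - x < 1 / (m + 1) := by linarith
        rw [lt_div_iff₀ hm] at this
        linarith
  · have h1 : |r m x| ≤ C0 := by
      simp only [hr, abs_mul]
      have := hC0 x ⟨hx.1.le, hx.2.le⟩
      calc |p m x| * |q m x| * |ρ x| ≤ 1 * 1 * C0 := by
            gcongr
            · exact hp1 m x
            · exact hq1 m x
            · exact this
        _ = C0 := by ring
    nlinarith [mul_nonneg hM0 hΛ0]
  · have hd := (((hdp m x).mul (hdq m x)).mul (hρ.differentiable (by simp) x).hasDerivAt).deriv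
    have e : deriv (r m) x = (deriv stepFn ((m + 1) * (x - a)) * (m + 1)) * ρ x * q m x
        - (deriv stepFn ((m + 1) * (b - x)) * (m + 1)) * ρ x * p m x
        + p m x * q m x * deriv ρ x := by
      have : deriv (r m) x = _ := hd
      rw [this]; simp only [Pi.mul_apply]; ring
    have hk : ∀ c : ℝ, 0 < c → |ρ x| ≤ Λ * c →
        |deriv stepFn ((m + 1) * c) * (m + 1) * ρ x| ≤ M * Λ := by
      intro c hc hρc
      have h1 := hM ((m + 1) * c)
      have hm : (0 : ℝ) < m + 1 := by positivity
      rw [abs_mul, abs_of_pos (by positivity : 0 < ((m : ℝ) + 1) * c)] at h1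
      rw [abs_mul, abs_mul, abs_of_pos hm]
      calc |deriv stepFn ((m + 1) * c)| * (m + 1) * |ρ x|
          ≤ |deriv stepFn ((m + 1) * c)| * (m + 1) * (Λ * c) := by gcongr
        _ = ((m + 1) * c * |deriv stepFn ((m + 1) * c)|) * Λ := by ring
        _ ≤ M * Λ := by gcongr
    have hk1 := hk _ (sub_pos.2 hx.1) (hla x hx)
    have hk2 := hk _ (sub_pos.2 hx.2) (hlb x hx)
    have hml : ∀ {s t S : ℝ}, |s| ≤ S → |t| ≤ 1 → |s * t| ≤ S := by
      intro s t S h1 h2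
      rw [abs_mul]
      nlinarith [abs_nonneg s, abs_nonneg t]
    have h3 := hml hk1 (hq1 m x)
    have h4 := hml hk2 (hp1 m x)
    have h5 : |p m x * q m x * deriv ρ x| ≤ Λ := by
      rw [mul_comm]
      exact hml (hΛ x ⟨hx.1.le, hx.2.le⟩) (hml (hp1 m x) (hq1 m x))
    rw [e]
    refine (abs_add_le _ _).trans ?_
    have := abs_sub (deriv stepFn ((m + 1) * (x - a)) * (m + 1) * ρ x * q m x)
      (deriv stepFn ((m + 1) * (b - x)) * (m + 1) * ρ x * p m x)
    linarith
  · refine tendsto_const_nhds.congr' ?_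
    filter_upwards [hloc x hx] with m hm using hm.eq_of_nhds.symm
  · refine tendsto_const_nhds.congr' ?_
    filter_upwards [hloc x hx] with m hm using hm.deriv_eq.symm

/-! ### Integration over the space-time cylinder -/

lemma tendsto_integral_mul_of_bdd {X : Type*} [MeasurableSpace X] {μ : Measure X} {F : X → ℝ}
    (hF : Integrable F μ) {φ : ℕ → X → ℝ} {ψ : X → ℝ} {C : ℝ}
    (hm : ∀ m, AEStronglyMeasurable (φ m) μ) (hb : ∀ m, ∀ᵐ x ∂μ, |φ m x| ≤ C)
    (hl : ∀ᵐ x ∂μ, Tendsto (fun m => φ m x) atTop (nhds (ψ x))) :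
    Tendsto (fun m => ∫ x, F x * φ m x ∂μ) atTop (nhds (∫ x, F x * ψ x ∂μ)) := by
  refine tendsto_integral_of_dominated_convergence (fun x => ‖F x‖ * C)
    (fun m => hF.1.mul (hm m)) (hF.norm.mul_const C) (fun m => ?_) ?_
  · filter_upwards [hb m] with x hx
    rw [norm_mul]
    exact mul_le_mul_of_nonneg_left hx (norm_nonneg _)
  · filter_upwards [hl] with x hx using hx.const_mul _

/-- The space-time measure is a product. -/
lemma restrict_cyl (a b T : ℝ) :
    (volume : Measure (ℝ × ℝ)).restrict (Ioo a b ×ˢ Ioo 0 T)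
      = (volume.restrict (Ioo a b)).prod (volume.restrict (Ioo 0 T)) := by
  rw [Measure.prod_restrict, Measure.volume_eq_prod]

lemma exists_bound_Ioo {a b : ℝ} {ρ : ℝ → ℝ} (hρ : Continuous ρ) :
    ∃ C, 0 ≤ C ∧ ∀ x ∈ Ioo a b, |ρ x| ≤ C := by
  obtain ⟨C, hC⟩ := isCompact_Icc.exists_bound_of_continuousOn (s := Icc a b) hρ.continuousOn
  exact ⟨max C 0, le_max_right _ _, fun x hx =>
    (hC x (Ioo_subset_Icc_self hx)).trans (le_max_left _ _)⟩

lemma measurableSet_cyl (a b T : ℝ) : MeasurableSet (Ioo a b ×ˢ Ioo 0 T) :=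
  measurableSet_Ioo.prod measurableSet_Ioo

lemma integrable_mul_space {a b T : ℝ} {F : ℝ → ℝ → ℝ}
    (hF : IntegrableOn (fun p : ℝ × ℝ => F p.1 p.2) (Ioo a b ×ˢ Ioo 0 T)) {ρ : ℝ → ℝ}
    (hρ : Continuous ρ) :
    IntegrableOn (fun p : ℝ × ℝ => F p.1 p.2 * ρ p.1) (Ioo a b ×ˢ Ioo 0 T) := by
  obtain ⟨C, -, hC⟩ := exists_bound_Ioo (a := a) (b := b) hρ
  refine Integrable.mul_bdd (c := C) hF (by fun_prop) ?_
  filter_upwards [ae_restrict_mem (measurableSet_cyl a b T)] with p hp using hC _ hp.1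

lemma integrable_mul_time {a b T : ℝ} {F : ℝ → ℝ → ℝ}
    (hF : IntegrableOn (fun p : ℝ × ℝ => F p.1 p.2) (Ioo a b ×ˢ Ioo 0 T)) {η : ℝ → ℝ}
    (hη : Continuous η) :
    IntegrableOn (fun p : ℝ × ℝ => F p.1 p.2 * η p.2) (Ioo a b ×ˢ Ioo 0 T) := by
  obtain ⟨C, -, hC⟩ := exists_bound_Ioo (a := 0) (b := T) hη
  refine Integrable.mul_bdd (c := C) hF (by fun_prop) ?_
  filter_upwards [ae_restrict_mem (measurableSet_cyl a b T)] with p hp using hC _ hp.2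

lemma integrableOn_intOm {a b T : ℝ} {F : ℝ → ℝ → ℝ}
    (hF : IntegrableOn (fun p : ℝ × ℝ => F p.1 p.2) (Ioo a b ×ˢ Ioo 0 T)) :
    IntegrableOn (fun t => ∫ x in Ioo a b, F x t) (Ioo 0 T) := by
  rw [IntegrableOn, restrict_cyl] at hF
  exact hF.integral_prod_right

lemma intOmT_eq {a b T : ℝ} {F : ℝ → ℝ → ℝ}
    (hF : IntegrableOn (fun p : ℝ × ℝ => F p.1 p.2) (Ioo a b ×ˢ Ioo 0 T)) :
    intOmT a b T F = ∫ t in Ioo 0 T, ∫ x in Ioo a b, F x t := by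
  rw [IntegrableOn, restrict_cyl] at hF
  rw [intOmT, restrict_cyl, integral_prod_symm _ hF]

/-- Fubini's theorem for integrals against products `ρ(x) η(t)`. -/
lemma intOmT_mul {a b T : ℝ} {F : ℝ → ℝ → ℝ}
    (hF : IntegrableOn (fun p : ℝ × ℝ => F p.1 p.2) (Ioo a b ×ˢ Ioo 0 T)) {ρ η : ℝ → ℝ}
    (hρ : Continuous ρ) (hη : Continuous η) :
    intOmT a b T (fun x t => F x t * (ρ x * η t))
      = ∫ t in Ioo 0 T, (∫ x in Ioo a b, F x t * ρ x) * η t := by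
  have h1 := integrable_mul_time (F := fun x t => F x t * ρ x) (integrable_mul_space hF hρ) hη
  simp only [← mul_assoc]
  rw [intOmT_eq h1]
  simp only [integral_mul_const]

/-- Convergence of space-time integrals under bounded pointwise convergence in space. -/
lemma tendsto_intOmT {a b T : ℝ} {F : ℝ → ℝ → ℝ}
    (hF : IntegrableOn (fun p : ℝ × ℝ => F p.1 p.2) (Ioo a b ×ˢ Ioo 0 T)) {r : ℕ → ℝ → ℝ}
    {ρ η : ℝ → ℝ} {C : ℝ} (hr : ∀ m, Continuous (r m)) (hη : Continuous η)
    (hb : ∀ m, ∀ x ∈ Ioo a b, |r m x| ≤ C)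
    (hl : ∀ x ∈ Ioo a b, Tendsto (fun m => r m x) atTop (nhds (ρ x))) :
    Tendsto (fun m => intOmT a b T (fun x t => F x t * (r m x * η t))) atTop
      (nhds (intOmT a b T (fun x t => F x t * (ρ x * η t)))) := by
  have h1 := integrable_mul_time hF hη
  have := tendsto_integral_mul_of_bdd h1 (φ := fun m p => r m p.1) (ψ := fun p => ρ p.1) (C := C)
    (fun m => by have := hr m; fun_prop)
    (fun m => by
      filter_upwards [ae_restrict_mem (measurableSet_cyl a b T)] with p hp using hb m _ hp.1)
    (by filter_upwards [ae_restrict_mem (measurableSet_cyl a b T)] with p hp using hl _ hp.1)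
  have e : ∀ ψ : ℝ → ℝ, intOmT a b T (fun x t => F x t * (ψ x * η t))
      = ∫ p in Ioo a b ×ˢ Ioo 0 T, F p.1 p.2 * η p.2 * ψ p.1 := fun ψ =>
    integral_congr_ae (ae_of_all _ fun p => by simp only; ring)
  rw [e ρ]
  simpa only [e] using this

lemma tendsto_intOm {a b : ℝ} {F : ℝ → ℝ} (hF : IntegrableOn F (Ioo a b)) {r : ℕ → ℝ → ℝ}
    {ρ : ℝ → ℝ} {C : ℝ} (hr : ∀ m, Continuous (r m))
    (hb : ∀ m, ∀ x ∈ Ioo a b, |r m x| ≤ C)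
    (hl : ∀ x ∈ Ioo a b, Tendsto (fun m => r m x) atTop (nhds (ρ x))) :
    Tendsto (fun m => ∫ x in Ioo a b, F x * r m x) atTop (nhds (∫ x in Ioo a b, F x * ρ x)) :=
  tendsto_integral_mul_of_bdd hF (C := C) (fun m => (hr m).aestronglyMeasurable)
    (fun m => by filter_upwards [ae_restrict_mem measurableSet_Ioo] with p hp using hb m _ hp)
    (by filter_upwards [ae_restrict_mem measurableSet_Ioo] with p hp using hl _ hp)

/-! ### Continuity in time of spatial integrals -/

lemma MemL2.mul_integrable {a b : ℝ} {g h : ℝ → ℝ} (hg : MemL2 a b g) (hh : MemL2 a b h) :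
    IntegrableOn (fun x => g x * h x) (Ioo a b) :=
  (memL2_iff.1 hg).integrable_mul (memL2_iff.1 hh)

lemma memL2_of_continuous (a b : ℝ) {g : ℝ → ℝ} (hg : Continuous g) : MemL2 a b g :=
  ⟨hg.aestronglyMeasurable, ((hg.pow 2).integrableOn_Icc (a := a) (b := b)).mono_set
    Ioo_subset_Icc_self⟩

lemma inner_toLp_eq {a b : ℝ} {g h : ℝ → ℝ} (hg : MemLp g 2 (volume.restrict (Ioo a b)))
    (hh : MemLp h 2 (volume.restrict (Ioo a b))) :
    inner ℝ (hg.toLp g) (hh.toLp h) = ∫ x in Ioo a b, g x * h x := by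
  rw [L2.inner_def]
  refine integral_congr_ae ?_
  filter_upwards [hg.coeFn_toLp, hh.coeFn_toLp] with x h1 h2
  rw [h1, h2]
  simp [mul_comm]

lemma ContL2.continuous_toLp {a b : ℝ} {J : Set ℝ} {w : ℝ → ℝ → ℝ} (hw : ContL2 a b J w) :
    Continuous fun t : J => (memL2_iff.1 (hw.1 t t.2)).toLp (fun x => w x t) := by
  rw [continuous_iff_continuousAt]
  intro t₀
  rw [ContinuousAt, tendsto_iff_norm_sub_tendsto_zero]
  have h0 := hw.2 t₀ t₀.2
  rw [← map_nhds_subtype_val, tendsto_map'_iff] at h0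
  have h1 := (Real.continuous_sqrt.tendsto 0).comp h0
  rw [Real.sqrt_zero] at h1
  refine h1.congr fun t => ?_
  rw [← MemLp.toLp_sub, comp_apply, comp_apply, ← Real.sqrt_sq (norm_nonneg (MemLp.toLp _ _)),
    ← real_inner_self_eq_norm_sq, inner_toLp_eq]
  simp only [Pi.sub_apply, ← sq]

lemma ContL2.continuousOn_integral_mul {a b : ℝ} {J : Set ℝ} {w : ℝ → ℝ → ℝ}
    (hw : ContL2 a b J w) {g : ℝ → ℝ} (hg : MemL2 a b g) :
    ContinuousOn (fun t => ∫ x in Ioo a b, w x t * g x) J := by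
  rw [continuousOn_iff_continuous_domRestrict]
  have := hw.continuous_toLp.inner (𝕜 := ℝ) (continuous_const (y := (memL2_iff.1 hg).toLp g))
  simp only [inner_toLp_eq] at this
  exact this

lemma ContL2.continuousOn_sq {a b : ℝ} {J : Set ℝ} {w : ℝ → ℝ → ℝ} (hw : ContL2 a b J w) :
    ContinuousOn (fun t => ∫ x in Ioo a b, (w x t) ^ 2) J := by
  rw [continuousOn_iff_continuous_domRestrict]
  have := hw.continuous_toLp.inner (𝕜 := ℝ) hw.continuous_toLp
  simp only [inner_toLp_eq, ← sq] at this
  exact this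

/-! ### Modes -/

lemma contDiff_sinM (a b : ℝ) (n : ℤ) : ContDiff ℝ (⊤ : ℕ∞) (sinM a b n) := by
  unfold sinM; fun_prop

lemma contDiff_cosM (a b : ℝ) (n : ℤ) : ContDiff ℝ (⊤ : ℕ∞) (cosM a b n) := by
  unfold cosM; fun_prop

lemma hasDerivAt_freq (a b : ℝ) (n : ℤ) (x : ℝ) :
    HasDerivAt (fun x => freq a b n * (x - a)) (freq a b n) x := by
  simpa using ((hasDerivAt_id x).sub_const a).const_mul (freq a b n)

lemma deriv_sinM (a b : ℝ) (n : ℤ) (x : ℝ) :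
    deriv (sinM a b n) x = freq a b n * cosM a b n x := by
  have h : deriv (sinM a b n) x = _ := (hasDerivAt_freq a b n x).sin.deriv
  rw [h, mul_comm, cosM]

lemma deriv_cosM (a b : ℝ) (n : ℤ) (x : ℝ) :
    deriv (cosM a b n) x = -(freq a b n * sinM a b n x) := by
  have h : deriv (cosM a b n) x = _ := (hasDerivAt_freq a b n x).cos.deriv
  rw [h, sinM]; ring

lemma sinM_left (a b : ℝ) (n : ℤ) : sinM a b n a = 0 := by simp [sinM]

lemma sinM_right {a b : ℝ} (hab : a < b) (n : ℤ) : sinM a b n b = 0 := by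
  rw [sinM, freq, div_mul_cancel₀ _ (sub_pos.2 hab).ne', Real.sin_int_mul_pi]

lemma WeakDerivZ.integral_cosM {a b : ℝ} {g g' : ℝ → ℝ} (h : WeakDerivZ a b g g') (n : ℤ) :
    ∫ x in Ioo a b, g' x * cosM a b n x = freq a b n * ∫ x in Ioo a b, g x * sinM a b n x := by
  have := h _ (contDiff_cosM a b n)
  rw [← neg_eq_iff_eq_neg, ← integral_neg] at this
  rw [← this, ← integral_const_mul]
  refine integral_congr_ae (ae_of_all _ fun x => ?_)
  simp only [deriv_cosM]; ring

/-! ### Separated test functions -/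

lemma pdt_sep (r η : ℝ → ℝ) : pdt (fun x t => r x * η t) = fun x t => r x * deriv η t := by
  ext x t; exact deriv_const_mul_field _

lemma pdx_sep (r η : ℝ → ℝ) : pdx (fun x t => r x * η t) = fun x t => deriv r x * η t := by
  ext x t; exact deriv_mul_const_field _

lemma contDiff_sep {r η : ℝ → ℝ} (hr : ContDiff ℝ (⊤ : ℕ∞) r) (hη : ContDiff ℝ (⊤ : ℕ∞) η) :
    ContDiff ℝ (⊤ : ℕ∞) (uncurry fun x t => r x * η t) :=
  (hr.comp contDiff_fst).mul (hη.comp contDiff_snd)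

lemma ContDiff.deriv_top {η : ℝ → ℝ} (hη : ContDiff ℝ (⊤ : ℕ∞) η) :
    ContDiff ℝ (⊤ : ℕ∞) (deriv η) :=
  ((contDiff_infty_iff_deriv (𝕜 := ℝ)).1 hη).2

/-- Smooth functions of time vanishing near and beyond `T`. -/
def TimeTestR (T : ℝ) (η : ℝ → ℝ) : Prop :=
  ContDiff ℝ (⊤ : ℕ∞) η ∧ ∃ T' < T, ∀ t, T' ≤ t → η t = 0

lemma IsWeakSol.ut_mode {a b T : ℝ} (hab : a < b) {f f' u0 u0t Θ0 : ℝ → ℝ}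
    {u ut ux Θ Θx : ℝ → ℝ → ℝ} (hsol : IsWeakSol a b T f f' u0 u0t Θ0 u ut ux Θ Θx)
    {ρ η : ℝ → ℝ} (hρ : ContDiff ℝ (⊤ : ℕ∞) ρ) (ha : ρ a = 0) (hb : ρ b = 0)
    (hη : TimeTest T η) :
    ∫ t in Ioo 0 T, (∫ x in Ioo a b, u x t * ρ x) * deriv η t
      = -∫ t in Ioo 0 T, (∫ x in Ioo a b, ut x t * ρ x) * η t := by
  obtain ⟨C, r, hr, hrK, hrb, -, hrl, -⟩ := exists_cutoff hab hρ ha hb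
  obtain ⟨hηc, α, β, hα, hβ, hη0⟩ := hη
  have hd := hηc.deriv_top
  have h1 := tendsto_intOmT hsol.u_int (fun m => (hr m).continuous) hd.continuous hrb hrl
  have h2 := (tendsto_intOmT hsol.ut_int (fun m => (hr m).continuous) hηc.continuous hrb hrl).neg
  rw [← intOmT_mul hsol.u_int hρ.continuous hd.continuous,
    ← intOmT_mul hsol.ut_int hρ.continuous hηc.continuous]
  refine tendsto_nhds_unique h1 (h2.congr fun m => ?_)
  obtain ⟨K, hK, hKs, hK0⟩ := hrK m
  have := hsol.ut_weak (fun x t => r m x * η t) ⟨contDiff_sep (hr m) hηc,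
    ⟨K, hK, hKs, fun x t hx => by rw [hK0 x hx, zero_mul]⟩,
    ⟨Icc α β, isCompact_Icc, fun t ht => ⟨hα.trans_le ht.1, ht.2.trans_lt hβ⟩,
      fun x t ht => by rw [hη0 t ht, mul_zero]⟩⟩
  rw [pdt_sep] at this
  exact this.symm

lemma IsWeakSol.u_mode {a b T : ℝ} (hab : a < b) {f f' u0 u0t Θ0 : ℝ → ℝ}
    {u ut ux Θ Θx : ℝ → ℝ → ℝ} (hsol : IsWeakSol a b T f f' u0 u0t Θ0 u ut ux Θ Θx)
    (hu0 : IntegrableOn u0 (Ioo a b)) (hu0t : IntegrableOn u0t (Ioo a b))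
    {ρ η : ℝ → ℝ} (hρ : ContDiff ℝ (⊤ : ℕ∞) ρ) (ha : ρ a = 0) (hb : ρ b = 0)
    (hη : TimeTestR T η) :
    (∫ t in Ioo 0 T, (∫ x in Ioo a b, u x t * ρ x) * deriv (deriv η) t)
        - (∫ x in Ioo a b, u0t x * ρ x) * η 0 + (∫ x in Ioo a b, u0 x * ρ x) * deriv η 0
      = -(∫ t in Ioo 0 T, (∫ x in Ioo a b, ux x t * deriv ρ x) * η t)
        - ∫ t in Ioo 0 T, (∫ x in Ioo a b, f' (Θ x t) * Θx x t * ρ x) * η t := by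
  obtain ⟨C, r, hr, hrK, hrb, hrb', hrl, hrl'⟩ := exists_cutoff hab hρ ha hb
  obtain ⟨hηc, T', hT', hη0⟩ := hη
  have hd := hηc.deriv_top
  have hdd := hd.deriv_top
  have hrc := fun m => (hr m).continuous
  have h1 := tendsto_intOmT hsol.u_int hrc hdd.continuous hrb hrl
  have h2 := (tendsto_intOm hu0t hrc hrb hrl).mul_const (η 0)
  have h3 := (tendsto_intOm hu0 hrc hrb hrl).mul_const (deriv η 0)
  have h4 := tendsto_intOmT hsol.ux_int (fun m => (hr m).deriv_top.continuous) hηc.continuous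
    hrb' hrl'
  have h5 := tendsto_intOmT (F := fun x t => f' (Θ x t) * Θx x t) hsol.g1_int hrc
    hηc.continuous hrb hrl
  rw [← intOmT_mul hsol.u_int hρ.continuous hdd.continuous,
    ← intOmT_mul hsol.ux_int hρ.deriv_top.continuous hηc.continuous,
    ← intOmT_mul (F := fun x t => f' (Θ x t) * Θx x t) hsol.g1_int hρ.continuous hηc.continuous]
  refine tendsto_nhds_unique ((h1.sub h2).add h3) ((h4.neg.sub h5).congr fun m => ?_)
  obtain ⟨K, hK, hKs, hK0⟩ := hrK m
  have := hsol.weak_u (fun x t => r m x * η t) ⟨contDiff_sep (hr m) hηc,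
    ⟨K, hK, hKs, fun x t hx => by rw [hK0 x hx, zero_mul]⟩,
    ⟨T', hT', fun x t ht => by rw [hη0 t ht, mul_zero]⟩⟩
  simp only [pdt_sep, pdx_sep, intOm, ← mul_assoc, integral_mul_const] at this ⊢
  exact this.symm

lemma IsWeakSol.Θ_mode {a b T : ℝ} {f f' u0 u0t Θ0 : ℝ → ℝ}
    {u ut ux Θ Θx : ℝ → ℝ → ℝ} (hsol : IsWeakSol a b T f f' u0 u0t Θ0 u ut ux Θ Θx)
    {η : ℝ → ℝ} (hη : TimeTestR T η) :
    -(∫ t in Ioo 0 T, (∫ x in Ioo a b, Θ x t) * deriv η t) - (∫ x in Ioo a b, Θ0 x) * η 0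
      = ∫ t in Ioo 0 T, (∫ x in Ioo a b, f' (Θ x t) * Θx x t * ut x t) * η t := by
  obtain ⟨hηc, T', hT', hη0⟩ := hη
  have h1 := intOmT_mul hsol.Θ_int (continuous_const (y := (1 : ℝ))) hηc.deriv_top.continuous
  have h2 := intOmT_mul (F := fun x t => f' (Θ x t) * Θx x t * ut x t) hsol.g2_int
    (continuous_const (y := (1 : ℝ))) hηc.continuous
  have := hsol.weak_Θ (fun x t => 1 * η t) ⟨contDiff_sep contDiff_const hηc,
    ⟨T', hT', fun x t ht => by rw [hη0 t ht, mul_zero]⟩⟩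
  rw [pdt_sep, pdx_sep] at this
  simp only [mul_one] at h1 h2
  rw [h1, h2] at this
  simpa [intOmT, intOm, integral_mul_const] using this

lemma TimeTest.timeTestR {T : ℝ} {η : ℝ → ℝ} (h : TimeTest T η) : TimeTestR T η := by
  obtain ⟨hc, α, β, -, hβ, h0⟩ := h
  refine ⟨hc, (β + T) / 2, by linarith, fun t ht => h0 t fun h => ?_⟩
  linarith [h.2]

lemma TimeTest.eventuallyEq_zero {T : ℝ} {η : ℝ → ℝ} (h : TimeTest T η) :
    η =ᶠ[nhds 0] fun _ => 0 := by
  obtain ⟨-, α, β, hα, -, h0⟩ := h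
  filter_upwards [Iio_mem_nhds hα] with t ht using h0 t fun h => not_le.2 ht h.1

lemma TimeTestR.deriv {T : ℝ} {η : ℝ → ℝ} (h : TimeTestR T η) : TimeTestR T (deriv η) := by
  obtain ⟨hc, T', hT', h0⟩ := h
  refine ⟨hc.deriv_top, (T' + T) / 2, by linarith, fun t ht => ?_⟩
  have : η =ᶠ[nhds t] fun _ => 0 := by
    filter_upwards [Ioi_mem_nhds (show T' < t by linarith)] with s hs using h0 s (le_of_lt hs)
  rw [this.deriv_eq]; simp

lemma TimeTestR.eq_zero {T : ℝ} {η : ℝ → ℝ} (h : TimeTestR T η) : η T = 0 := by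
  obtain ⟨-, T', hT', h0⟩ := h
  exact h0 T hT'.le

lemma exists_timeTestR {T : ℝ} (hT : 0 < T) :
    ∃ χ : ℝ → ℝ, TimeTestR T χ ∧ χ =ᶠ[nhds 0] fun _ => 1 := by
  refine ⟨fun t => stepFn (3 - 4 / T * t), ⟨stepFn_contDiff.comp (by fun_prop), T / 2,
    by linarith, fun t ht => stepFn_eq_zero ?_⟩, ?_⟩
  · have : 4 / T * (T / 2) ≤ 4 / T * t := by gcongr
    have e : 4 / T * (T / 2) = 2 := by field_simp; norm_num
    linarith
  · filter_upwards [Iio_mem_nhds (show (0 : ℝ) < T / 4 by linarith)] with t ht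
    refine stepFn_eq_one ?_
    have : 4 / T * t ≤ 4 / T * (T / 4) := by gcongr; exact le_of_lt ht
    have e : 4 / T * (T / 4) = 1 := by field_simp
    linarith

/-- A first order weak equation with initial value. -/
lemma isPrimOn_of_weak_init {T : ℝ} (hT : 0 < T) {F G : ℝ → ℝ} {c : ℝ}
    (hF : ContinuousOn F (Icc 0 T)) (hG : IntegrableOn G (Ioo 0 T))
    (h : ∀ η, TimeTestR T η →
      -(∫ t in Ioo 0 T, F t * deriv η t) - c * η 0 = ∫ t in Ioo 0 T, G t * η t) :
    IsPrimOn T F G ∧ F 0 = c := by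
  have hP : IsPrimOn T F G := by
    refine isPrimOn_of_weak hT hF hG fun η hη => ?_
    have := h η hη.timeTestR
    rw [hη.eventuallyEq_zero.eq_of_nhds] at this
    linarith
  refine ⟨hP, ?_⟩
  obtain ⟨χ, hχ, hχ1⟩ := exists_timeTestR hT
  have h1 := h χ hχ
  rw [hP.integral_mul_deriv hT.le hχ.1 hχ.eq_zero, hχ1.eq_of_nhds] at h1
  linarith

/-- A second order weak equation with initial values. -/
lemma isPrimOn_of_weak_second {T : ℝ} (hT : 0 < T) {B D G : ℝ → ℝ} {c d : ℝ}
    (hB : IsPrimOn T B D) (hD : ContinuousOn D (Icc 0 T)) (hG : IntegrableOn G (Ioo 0 T))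
    (h : ∀ η, TimeTestR T η → (∫ t in Ioo 0 T, B t * deriv (deriv η) t) - d * η 0
      + c * deriv η 0 = ∫ t in Ioo 0 T, G t * η t) :
    IsPrimOn T D G ∧ D 0 = d ∧ B 0 = c := by
  have h' : ∀ η, TimeTestR T η → -(∫ t in Ioo 0 T, D t * deriv η t) - d * η 0
      - (B 0 - c) * deriv η 0 = ∫ t in Ioo 0 T, G t * η t := by
    intro η hη
    rw [← h η hη, hB.integral_mul_deriv hT.le hη.deriv.1 hη.deriv.eq_zero]
    ring
  have hP : IsPrimOn T D G := by
    refine isPrimOn_of_weak hT hD hG fun η hη => ?_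
    have := h' η hη.timeTestR
    rw [hη.eventuallyEq_zero.eq_of_nhds, hη.eventuallyEq_zero.deriv_eq] at this
    simp only [deriv_const] at this
    linarith
  obtain ⟨χ, hχ, hχ1⟩ := exists_timeTestR hT
  have h1 := h' χ hχ
  rw [hP.integral_mul_deriv hT.le hχ.1 hχ.eq_zero, hχ1.eq_of_nhds, hχ1.deriv_eq] at h1
  simp only [deriv_const] at h1
  have hξ : TimeTestR T (fun t => t * χ t) := by
    obtain ⟨hc, T', hT', h0⟩ := hχ
    exact ⟨contDiff_id.mul hc, T', hT', fun t ht => by simp [h0 t ht]⟩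
  have hξ1 : (fun t => t * χ t) =ᶠ[nhds 0] fun t => t := by
    filter_upwards [hχ1] with t ht
    rw [ht, mul_one]
  have h2 := h' _ hξ
  rw [hP.integral_mul_deriv hT.le hξ.1 hξ.eq_zero, hξ1.deriv_eq] at h2
  simp only [deriv_id'', zero_mul, mul_zero] at h2
  exact ⟨hP, by linarith, by linarith⟩

/-! ### The forcing term -/

lemma IsWeakSol.sq_integrable {a b T : ℝ} {f f' f'' u0 u0t Θ0 : ℝ → ℝ} (hf : HypF f f' f'')
    {u ut ux Θ Θx : ℝ → ℝ → ℝ} (hsol : IsWeakSol a b T f f' u0 u0t Θ0 u ut ux Θ Θx)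
    (hΘx : IntegrableOn (fun p : ℝ × ℝ => (Θx p.1 p.2) ^ 2) (Ioo a b ×ˢ Ioo 0 T)) :
    IntegrableOn (fun p : ℝ × ℝ => (f' (Θ p.1 p.2) * Θx p.1 p.2) ^ 2) (Ioo a b ×ˢ Ioo 0 T) := by
  obtain ⟨M, hM⟩ := hf.bdd
  refine Integrable.mono' (hΘx.const_mul (M ^ 2)) (hsol.g1_int.1.pow 2) ?_
  filter_upwards [hsol.Θ_nonneg] with p hp
  rw [Real.norm_of_nonneg (sq_nonneg _), mul_pow]
  have h1 : f' (Θ p.1 p.2) ^ 2 ≤ M ^ 2 := sq_le_sq.2 ((hM _ hp).1.trans (le_abs_self M))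
  gcongr

lemma ae_memL2_slice {a b T : ℝ} {h : ℝ → ℝ → ℝ}
    (h1 : IntegrableOn (fun p : ℝ × ℝ => h p.1 p.2) (Ioo a b ×ˢ Ioo 0 T))
    (h2 : IntegrableOn (fun p : ℝ × ℝ => (h p.1 p.2) ^ 2) (Ioo a b ×ˢ Ioo 0 T)) :
    ∀ᵐ t ∂volume.restrict (Ioo 0 T), MemL2 a b (fun x => h x t) := by
  rw [IntegrableOn, restrict_cyl] at h1 h2
  filter_upwards [h1.prod_left_ae, h2.prod_left_ae] with t h3 h4 using ⟨h3.1, h4⟩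

/-! ### Energy balance for each mode and for their sum -/

lemma mode_energy {B D H : ℝ → ℝ} {T lam : ℝ} (hT : 0 ≤ T) (hB : IsPrimOn T B D)
    (hD : IsPrimOn T D fun t => -(lam ^ 2 * B t) - H t) :
    D T ^ 2 + (lam * B T) ^ 2
      = D 0 ^ 2 + (lam * B 0) ^ 2 - 2 * ∫ t in (0 : ℝ)..T, H t * D t := by
  have h1 := hB.integral_mul hT hB
  have h2 := hD.integral_mul hT hD
  have hBc := hB.continuousOn hT
  have hDc := hD.continuousOn hT
  have hI : uIcc 0 T = Icc 0 T := uIcc_of_le hT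
  have i1 : IntervalIntegrable (fun t => D t * B t + B t * D t) volume 0 T := by
    refine ContinuousOn.intervalIntegrable ?_
    rw [hI]
    exact (hDc.mul hBc).add (hBc.mul hDc)
  rw [← hI] at hDc
  have i2 : IntervalIntegrable (fun t => (-(lam ^ 2 * B t) - H t) * D t
      + D t * (-(lam ^ 2 * B t) - H t)) volume 0 T :=
    (hD.1.mul_continuousOn hDc).add (hD.1.continuousOn_mul hDc)
  have h3 := intervalIntegral.integral_add (i1.const_mul (lam ^ 2)) i2
  rw [intervalIntegral.integral_const_mul, h1, h2] at h3
  have h4 : ∫ t in (0 : ℝ)..T, (lam ^ 2 * (D t * B t + B t * D t)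
      + ((-(lam ^ 2 * B t) - H t) * D t + D t * (-(lam ^ 2 * B t) - H t)))
      = -2 * ∫ t in (0 : ℝ)..T, H t * D t := by
    rw [← intervalIntegral.integral_const_mul]
    exact intervalIntegral.integral_congr fun t _ => by ring
  rw [h4] at h3
  linarith

lemma hasSum_integral_modes {a b T : ℝ} (hab : a < b) {h w : ℝ → ℝ → ℝ}
    (h1 : IntegrableOn (fun p : ℝ × ℝ => h p.1 p.2) (Ioo a b ×ˢ Ioo 0 T))
    (h2 : IntegrableOn (fun p : ℝ × ℝ => (h p.1 p.2) ^ 2) (Ioo a b ×ˢ Ioo 0 T))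
    (hw : ContL2 a b (Icc 0 T) w) :
    HasSum (fun n : ℤ => ∫ t in Ioo 0 T,
        (∫ x in Ioo a b, h x t * sinM a b n x) * ∫ x in Ioo a b, w x t * sinM a b n x)
      (∫ t in Ioo 0 T, (b - a) * ∫ x in Ioo a b, h x t * w x t) := by
  have hsin := fun n => (contDiff_sinM a b n).continuous
  have hae : ∀ᵐ t ∂volume.restrict (Ioo 0 T), MemL2 a b (fun x => h x t) ∧
      MemL2 a b (fun x => w x t) := by
    filter_upwards [ae_memL2_slice h1 h2, ae_restrict_mem measurableSet_Ioo] with t h3 h4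
    exact ⟨h3, hw.1 t (Ioo_subset_Icc_self h4)⟩
  have hsum : ∀ᵐ t ∂volume.restrict (Ioo 0 T), HasSum (fun n : ℤ =>
      1 / 2 * ((∫ x in Ioo a b, h x t * sinM a b n x) ^ 2
        + (∫ x in Ioo a b, w x t * sinM a b n x) ^ 2))
      (1 / 2 * ((b - a) * (∫ x in Ioo a b, (h x t) ^ 2)
        + (b - a) * ∫ x in Ioo a b, (w x t) ^ 2)) := by
    filter_upwards [hae] with t ht
    exact ((parseval_sin hab ht.1).add (parseval_sin hab ht.2)).mul_left _
  have hwc : ∀ {F : ℝ → ℝ}, ContinuousOn F (Icc 0 T) → IntegrableOn F (Ioo 0 T) := fun hF =>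
    (hF.integrableOn_Icc).mono_set Ioo_subset_Icc_self
  refine hasSum_integral_of_dominated_convergence
    (fun n t => 1 / 2 * ((∫ x in Ioo a b, h x t * sinM a b n x) ^ 2
        + (∫ x in Ioo a b, w x t * sinM a b n x) ^ 2)) (fun n => ?_) (fun n => ?_) ?_ ?_ ?_
  · exact (integrableOn_intOm (F := fun x t => h x t * sinM a b n x)
      (integrable_mul_space h1 (hsin n))).1.mul
      (hwc (hw.continuousOn_integral_mul (memL2_of_continuous a b (hsin n)))).1
  · refine ae_of_all _ fun t => ?_
    rw [Real.norm_eq_abs, abs_mul]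
    nlinarith [sq_nonneg (|∫ x in Ioo a b, h x t * sinM a b n x|
      - |∫ x in Ioo a b, w x t * sinM a b n x|),
      sq_abs (∫ x in Ioo a b, h x t * sinM a b n x),
      sq_abs (∫ x in Ioo a b, w x t * sinM a b n x)]
  · filter_upwards [hsum] with t ht using ht.summable
  · refine Integrable.congr (f := fun t => 1 / 2 * ((b - a) * (∫ x in Ioo a b, (h x t) ^ 2)
        + (b - a) * ∫ x in Ioo a b, (w x t) ^ 2)) ?_ ?_
    · exact (((integrableOn_intOm (F := fun x t => h x t ^ 2) h2).const_mul _).add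
        ((hwc hw.continuousOn_sq).const_mul _)).const_mul _
    · filter_upwards [hsum] with t ht using ht.tsum_eq.symm
  · filter_upwards [hae] with t ht using parseval_sin_mul hab ht.1 ht.2

lemma ContL2.mono {a b : ℝ} {J J' : Set ℝ} {w : ℝ → ℝ → ℝ} (hw : ContL2 a b J w) (h : J' ⊆ J) :
    ContL2 a b J' w :=
  ⟨fun t ht => hw.1 t (h ht), fun t ht => (hw.2 t (h ht)).mono_left (nhdsWithin_mono _ h)⟩

lemma IsWeakSol.isPrimOn_modes {a b T : ℝ} (hab : a < b) (hT : 0 < T)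
    {f f' u0 u0x u0t Θ0 : ℝ → ℝ} (hdata : DataI a b u0 u0x u0t Θ0)
    {u ut ux Θ Θx : ℝ → ℝ → ℝ} (hsol : IsWeakSol a b T f f' u0 u0t Θ0 u ut ux Θ Θx)
    (hreg : RegT a b T u ut ux Θ Θx) (n : ℤ) :
    IsPrimOn T (fun t => ∫ x in Ioo a b, u x t * sinM a b n x)
        (fun t => ∫ x in Ioo a b, ut x t * sinM a b n x) ∧
      IsPrimOn T (fun t => ∫ x in Ioo a b, ut x t * sinM a b n x)
        (fun t => -(freq a b n ^ 2 * ∫ x in Ioo a b, u x t * sinM a b n x)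
          - ∫ x in Ioo a b, f' (Θ x t) * Θx x t * sinM a b n x) ∧
      (∫ x in Ioo a b, ut x 0 * sinM a b n x) = (∫ x in Ioo a b, u0t x * sinM a b n x) ∧
      (∫ x in Ioo a b, u x 0 * sinM a b n x) = ∫ x in Ioo a b, u0 x * sinM a b n x := by
  have hs := contDiff_sinM a b n
  have hs2 := memL2_of_continuous a b hs.continuous
  have h1 : MemL2 a b fun _ => 1 := memL2_of_continuous a b continuous_const
  have hBc := hreg.u_cont.continuousOn_integral_mul hs2
  have hDc := hreg.ut_cont.continuousOn_integral_mul hs2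
  have hD : IntegrableOn (fun t => ∫ x in Ioo a b, ut x t * sinM a b n x) (Ioo 0 T) :=
    hDc.integrableOn_Icc.mono_set Ioo_subset_Icc_self
  have hP : IsPrimOn T (fun t => ∫ x in Ioo a b, u x t * sinM a b n x)
      (fun t => ∫ x in Ioo a b, ut x t * sinM a b n x) :=
    isPrimOn_of_weak hT hBc hD fun η hη =>
      hsol.ut_mode hab hs (sinM_left a b n) (sinM_right hab n) hη
  have hB : IntegrableOn (fun t => freq a b n ^ 2 * ∫ x in Ioo a b, u x t * sinM a b n x)
      (Ioo 0 T) := (hBc.integrableOn_Icc.mono_set Ioo_subset_Icc_self).const_mul _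
  have hH : IntegrableOn (fun t => ∫ x in Ioo a b, f' (Θ x t) * Θx x t * sinM a b n x)
      (Ioo 0 T) := integrableOn_intOm (F := fun x t => f' (Θ x t) * Θx x t * sinM a b n x)
        (integrable_mul_space (F := fun x t => f' (Θ x t) * Θx x t) hsol.g1_int hs.continuous)
  refine ⟨hP, isPrimOn_of_weak_second hT hP hDc (hB.neg.sub hH) fun η hη => ?_⟩
  have hc := hη.1.continuous
  have hmul : ∀ {F : ℝ → ℝ}, IntegrableOn F (Ioo 0 T) → IntegrableOn (fun t => F t * η t)
      (Ioo 0 T) := by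
    intro F hF
    obtain ⟨C, -, hC⟩ := exists_bound_Ioo (a := 0) (b := T) hc
    refine Integrable.mul_bdd (c := C) hF hc.aestronglyMeasurable ?_
    filter_upwards [ae_restrict_mem measurableSet_Ioo] with t ht using hC t ht
  have := hsol.u_mode hab (by simpa using hdata.u0_L2.mul_integrable h1)
    (by simpa using hdata.u0t_L2.mul_integrable h1) hs (sinM_left a b n) (sinM_right hab n) hη
  have e : ∫ t in Ioo 0 T, (∫ x in Ioo a b, ux x t * deriv (sinM a b n) x) * η t
      = ∫ t in Ioo 0 T, (freq a b n ^ 2 * ∫ x in Ioo a b, u x t * sinM a b n x) * η t := by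
    refine setIntegral_congr_fun measurableSet_Ioo fun t ht => ?_
    have h3 := (hreg.u_W0 t (Ioo_subset_Icc_self ht)).integral_cosM n
    simp only [deriv_sinM, mul_left_comm _ (freq a b n), integral_const_mul, h3]
    ring
  rw [this, e, ← neg_add', ← integral_add (hmul hB) (hmul hH), ← integral_neg]
  refine integral_congr_ae (ae_of_all _ fun t => ?_)
  ring

lemma IsWeakSol.mechanical_energy {a b T : ℝ} (hab : a < b) (hT : 0 < T)
    {f f' f'' u0 u0x u0t Θ0 : ℝ → ℝ} (hf : HypF f f' f'') (hdata : DataI a b u0 u0x u0t Θ0)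
    {u ut ux Θ Θx : ℝ → ℝ → ℝ} (hsol : IsWeakSol a b T f f' u0 u0t Θ0 u ut ux Θ Θx)
    (hreg : RegT a b T u ut ux Θ Θx) {t : ℝ} (ht : t ∈ Icc 0 T) :
    (∫ x in Ioo a b, (ut x t) ^ 2) + (∫ x in Ioo a b, (ux x t) ^ 2)
      = (∫ x in Ioo a b, (u0t x) ^ 2) + (∫ x in Ioo a b, (u0x x) ^ 2)
        - 2 * ∫ s in (0 : ℝ)..t, ∫ x in Ioo a b, f' (Θ x s) * Θx x s * ut x s := by
  have hsub : Ioo a b ×ˢ Ioo 0 t ⊆ Ioo a b ×ˢ Ioo 0 T :=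
    prod_mono_right (Ioo_subset_Ioo_right ht.2)
  have hS := hasSum_integral_modes hab (h := fun x t => f' (Θ x t) * Θx x t)
    (hsol.g1_int.mono_set hsub) ((hsol.sq_integrable hf hreg.Θx_sq_int).mono_set hsub)
    (hreg.ut_cont.mono (Icc_subset_Icc_right ht.2))
  have hL := (parseval_sin hab (hreg.ut_cont.1 t ht)).add
    (parseval_cos hab (hreg.ux_cont.1 t ht))
  have hR := ((parseval_sin hab hdata.u0t_L2).add (parseval_cos hab hdata.u0x_L2)).sub
    (hS.mul_left 2)
  have hLR := hL.unique (hR.congr_of_eq (fun n => ?_) rfl)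
  · rw [integral_const_mul, setIntegral_Ioo_eq_interval ht.1] at hLR
    have hpos : 0 < b - a := sub_pos.2 hab
    refine mul_left_cancel₀ hpos.ne' ?_
    linarith
  · obtain ⟨h1, h2, h3, h4⟩ := hsol.isPrimOn_modes hab hT hdata hreg n
    have h5 := mode_energy ht.1 (h1.mono ht) (h2.mono ht)
    rw [h3, h4] at h5
    simp only [setIntegral_Ioo_eq_interval ht.1, (hreg.u_W0 t ht).integral_cosM n,
      hdata.u0_W0.integral_cosM n]
    exact h5

lemma IsWeakSol.thermal_energy {a b T : ℝ} (hT : 0 < T) {f f' u0 u0t Θ0 : ℝ → ℝ}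
    {u ut ux Θ Θx : ℝ → ℝ → ℝ} (hsol : IsWeakSol a b T f f' u0 u0t Θ0 u ut ux Θ Θx)
    (hΘ : ContL2 a b (Icc 0 T) Θ) {t : ℝ} (ht : t ∈ Icc 0 T) :
    ∫ x in Ioo a b, Θ x t = (∫ x in Ioo a b, Θ0 x)
      + ∫ s in (0 : ℝ)..t, ∫ x in Ioo a b, f' (Θ x s) * Θx x s * ut x s := by
  have hc := hΘ.continuousOn_integral_mul (memL2_of_continuous a b (continuous_const (y := 1)))
  simp only [mul_one] at hc
  obtain ⟨h1, h2⟩ := isPrimOn_of_weak_init hT hc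
    (integrableOn_intOm (F := fun x t => f' (Θ x t) * Θx x t * ut x t) hsol.g2_int)
    fun η hη => hsol.Θ_mode hη
  rw [← h2]
  exact h1.2 t ht

/-- Lemma 3.5: the energy identity for weak solutions in the class (R_T). -/
theorem statement7
    (a b : ℝ) (hab : a < b)
    (f f' f'' : ℝ → ℝ) (hf : HypF f f' f'')
    (u0 u0x u0t Θ0 : ℝ → ℝ) (hdata : DataI a b u0 u0x u0t Θ0)
    (T : ℝ) (hT : 0 < T)
    (u ut ux Θ Θx : ℝ → ℝ → ℝ)
    (hsol : IsWeakSol a b T f f' u0 u0t Θ0 u ut ux Θ Θx)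
    (hreg : RegT a b T u ut ux Θ Θx) :
    ∀ t ∈ Ioo 0 T,
      (1 / 2) * (∫ x in Ioo a b, (ut x t) ^ 2) + (1 / 2) * (∫ x in Ioo a b, (ux x t) ^ 2)
          + (∫ x in Ioo a b, Θ x t)
        = (1 / 2) * (∫ x in Ioo a b, (u0t x) ^ 2) + (1 / 2) * (∫ x in Ioo a b, (u0x x) ^ 2)
          + ∫ x in Ioo a b, Θ0 x := by
  intro t ht
  have h1 := hsol.mechanical_energy hab hT hf hdata hreg (Ioo_subset_Icc_self ht)
  have h2 := hsol.thermal_energy hT hreg.Θ_cont (Ioo_subset_Icc_self ht)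
  linarith
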